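/- arXiv:1604.08817 — 2 statements merged into one kernel-verified Lean document; each statement's English description precedes it below -/
import Mathlib

section
/- Let β ∈ {tw, la, pw, ppw}. (i) For every n ≥ 4, NGΠ↓ⁿ_β(2;n) = n − 3. (ii) For every fixed r ≥ 3 and all sufficiently large n, n/2 − r + 1 ≤ NGΠ↓ⁿ_β(r;n) ≤ n − 2r + 1. -/
open scoped Classical

namespace NG

/-- The set of earlier neighbors (back-neighborhood) of vertex `j` in `H`,
with respect to the natural order on `Fin N`. -/
noncomputable def backNbhd {N : ℕ} (H : SimpleGraph (Fin N)) (j : Fin N) :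
    Finset (Fin N) :=
  Finset.univ.filter (fun i => (i : ℕ) < (j : ℕ) ∧ H.Adj i j)

/-- The degree of `u` in the subgraph of `H` induced on the first `j` vertices
(the "stage `j`" graph of the construction). -/
noncomputable def stageDeg {N : ℕ} (H : SimpleGraph (Fin N)) (j : ℕ) (u : Fin N) : ℕ :=
  (Finset.univ.filter (fun w : Fin N => (w : ℕ) < j ∧ (u : ℕ) < j ∧ H.Adj u w)).card

/-- `H` on `Fin N` is a `k`-tree, built in the natural vertex order: the first
`k+1` vertices form a clique, and every later vertex is joined exactly to the
vertices of an existing `k`-clique. -/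
def IsKTreeOrd (k : ℕ) (N : ℕ) (H : SimpleGraph (Fin N)) : Prop :=
  1 ≤ k ∧ k + 1 ≤ N ∧
  (∀ i j : Fin N, (i : ℕ) < (j : ℕ) → (j : ℕ) ≤ k → H.Adj i j) ∧
  (∀ j : Fin N, k < (j : ℕ) →
    (backNbhd H j).card = k ∧ H.IsClique (backNbhd H j : Set (Fin N)))

/-- A linear `k`-tree: a `k`-tree in which each new vertex (after the first added
one) is joined to a `k`-clique containing the vertex added at the previous step. -/
def IsLinearKTreeOrd (k : ℕ) (N : ℕ) (H : SimpleGraph (Fin N)) : Prop :=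
  IsKTreeOrd k N H ∧
  ∀ i j : Fin N, (i : ℕ) + 1 = (j : ℕ) → k + 1 < (j : ℕ) → i ∈ backNbhd H j

/-- A `k`-caterpillar: a `k`-tree in which each new vertex (after the first added
one) is joined to a `k`-clique contained in the maximal `(k+1)`-clique created at
the previous stage. -/
def IsCaterpillarOrd (k : ℕ) (N : ℕ) (H : SimpleGraph (Fin N)) : Prop :=
  IsKTreeOrd k N H ∧
  ∀ i j : Fin N, (i : ℕ) + 1 = (j : ℕ) → k + 1 < (j : ℕ) →
    backNbhd H j ⊆ insert i (backNbhd H i)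

/-- A two-sided `k`-tree: a `k`-tree in which each new vertex is joined to a
`k`-clique that either contains a vertex of degree `k` (at that stage) or equals
the `k`-clique to which some previously added vertex was joined. -/
def IsTwoSidedKTreeOrd (k : ℕ) (N : ℕ) (H : SimpleGraph (Fin N)) : Prop :=
  IsKTreeOrd k N H ∧
  ∀ j : Fin N, k < (j : ℕ) →
    ((∃ u ∈ backNbhd H j, stageDeg H (j : ℕ) u = k) ∨
     (∃ i : Fin N, k < (i : ℕ) ∧ (i : ℕ) < (j : ℕ) ∧ backNbhd H i = backNbhd H j))

/-- The least `k` such that `G` embeds as a subgraph into some graph in the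
class `P k`; an edgeless graph gets the value `0`. -/
noncomputable def widthParam (P : ℕ → (N : ℕ) → SimpleGraph (Fin N) → Prop)
    (n : ℕ) (G : SimpleGraph (Fin n)) : ℕ :=
  if G = ⊥ then 0
  else sInf {k | ∃ (N : ℕ) (H : SimpleGraph (Fin N)) (f : Fin n ↪ Fin N),
    P k N H ∧ ∀ u v : Fin n, G.Adj u v → H.Adj (f u) (f v)}

/-- Tree-width: the least `k` such that `G` is a subgraph of a `k`-tree. -/
noncomputable def treewidth (n : ℕ) (G : SimpleGraph (Fin n)) : ℕ :=
  widthParam IsKTreeOrd n G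

/-- Largeur d'arborescence: the least `k` such that `G` is a subgraph of a
two-sided `k`-tree. -/
noncomputable def la (n : ℕ) (G : SimpleGraph (Fin n)) : ℕ :=
  widthParam IsTwoSidedKTreeOrd n G

/-- Path-width: the least `k` such that `G` is a subgraph of a `k`-caterpillar. -/
noncomputable def pw (n : ℕ) (G : SimpleGraph (Fin n)) : ℕ :=
  widthParam IsCaterpillarOrd n G

/-- Proper path-width: the least `k` such that `G` is a subgraph of a linear
`k`-tree. -/
noncomputable def ppw (n : ℕ) (G : SimpleGraph (Fin n)) : ℕ :=
  widthParam IsLinearKTreeOrd n G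

/-- `G` has a complete-graph minor on `m` branch sets: there are `m` pairwise
disjoint nonempty connected vertex sets with an edge between every two of them. -/
def HasCliqueMinor {n : ℕ} (G : SimpleGraph (Fin n)) (m : ℕ) : Prop :=
  ∃ B : Fin m → Finset (Fin n),
    (∀ p, (B p).Nonempty) ∧
    (∀ p, (G.induce ((B p : Finset (Fin n)) : Set (Fin n))).Connected) ∧
    (∀ p q, p ≠ q → Disjoint (B p) (B q)) ∧
    (∀ p q, p ≠ q → ∃ u ∈ B p, ∃ v ∈ B q, G.Adj u v)

/-- The Hadwiger number: the largest `m` such that `K_m` is a minor of `G`. -/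
noncomputable def hadwiger (n : ℕ) (G : SimpleGraph (Fin n)) : ℕ :=
  sSup {m | HasCliqueMinor G m}

/-- `A` is a symmetric matrix whose off-diagonal nonzero pattern is the
adjacency of `G`. -/
def DescribesGraph {n : ℕ} (A : Matrix (Fin n) (Fin n) ℝ)
    (G : SimpleGraph (Fin n)) : Prop :=
  A.IsSymm ∧ ∀ i j : Fin n, i ≠ j → (A i j ≠ 0 ↔ G.Adj i j)

/-- The Strong Arnold Property: the only symmetric `X` with `AX = O`,
`A∘X = O` and `I∘X = O` is `X = O`. -/
def StrongArnold {n : ℕ} (A : Matrix (Fin n) (Fin n) ℝ) : Prop :=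
  ∀ X : Matrix (Fin n) (Fin n) ℝ, X.IsSymm → A * X = 0 →
    (∀ i j, A i j * X i j = 0) → (∀ i, X i i = 0) → X = 0

/-- The nullity of a square real matrix. -/
noncomputable def nullity {n : ℕ} (A : Matrix (Fin n) (Fin n) ℝ) : ℕ :=
  Module.finrank ℝ (LinearMap.ker (Matrix.toLin' A))

/-- The Colin de Verdière type parameter `ξ`: maximum nullity of a matrix in
`S(G)` with the Strong Arnold Property. -/
noncomputable def xiParam (n : ℕ) (G : SimpleGraph (Fin n)) : ℕ :=
  sSup {m | ∃ A : Matrix (Fin n) (Fin n) ℝ,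
    DescribesGraph A G ∧ StrongArnold A ∧ nullity A = m}

/-- The Colin de Verdière type parameter `ν`: maximum nullity of a positive
semidefinite matrix in `S(G)` with the Strong Arnold Property. -/
noncomputable def nuParam (n : ℕ) (G : SimpleGraph (Fin n)) : ℕ :=
  sSup {m | ∃ A : Matrix (Fin n) (Fin n) ℝ,
    DescribesGraph A G ∧ A.PosSemidef ∧ StrongArnold A ∧ nullity A = m}

/-- The Colin de Verdière number `μ`: maximum nullity of a generalized
Laplacian in `S(G)` with exactly one negative eigenvalue and the Strong Arnold
Property. -/
noncomputable def muParam (n : ℕ) (G : SimpleGraph (Fin n)) : ℕ :=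
  sSup {m | ∃ (A : Matrix (Fin n) (Fin n) ℝ) (hA : A.IsHermitian),
    DescribesGraph A G ∧ StrongArnold A ∧
    (Finset.univ.filter (fun i => hA.eigenvalues i < 0)).card = 1 ∧
    (∀ i j : Fin n, i ≠ j → A i j ≤ 0) ∧ nullity A = m}

/-- An `r`-decomposition of `K_n`: spanning subgraphs with pairwise disjoint
edge sets whose union is all of `K_n`. -/
def IsDecomp {n r : ℕ} (G : Fin r → SimpleGraph (Fin n)) : Prop :=
  (∀ i j : Fin r, i ≠ j → Disjoint (G i) (G j)) ∧ (⨆ i, G i) = ⊤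

/-- A non-degenerate `r`-decomposition: every part has at least one edge. -/
def IsNDDecomp {n r : ℕ} (G : Fin r → SimpleGraph (Fin n)) : Prop :=
  IsDecomp G ∧ ∀ i, G i ≠ ⊥

/-- Nordhaus–Gaddum sum upper bound `NGΣ↑_β(r;n)`. -/
noncomputable def NGsumUp {n : ℕ} (β : SimpleGraph (Fin n) → ℕ) (r : ℕ) : ℕ :=
  sSup {s | ∃ G : Fin r → SimpleGraph (Fin n), IsDecomp G ∧ ∑ i, β (G i) = s}

/-- Nordhaus–Gaddum sum lower bound `NGΣ↓_β(r;n)`. -/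
noncomputable def NGsumLow {n : ℕ} (β : SimpleGraph (Fin n) → ℕ) (r : ℕ) : ℕ :=
  sInf {s | ∃ G : Fin r → SimpleGraph (Fin n), IsDecomp G ∧ ∑ i, β (G i) = s}

/-- Non-degenerate Nordhaus–Gaddum sum lower bound `NGΣ↓ⁿ_β(r;n)`. -/
noncomputable def NGsumLowND {n : ℕ} (β : SimpleGraph (Fin n) → ℕ) (r : ℕ) : ℕ :=
  sInf {s | ∃ G : Fin r → SimpleGraph (Fin n), IsNDDecomp G ∧ ∑ i, β (G i) = s}

/-- Nordhaus–Gaddum product upper bound `NGΠ↑_β(r;n)`. -/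
noncomputable def NGprodUp {n : ℕ} (β : SimpleGraph (Fin n) → ℕ) (r : ℕ) : ℕ :=
  sSup {s | ∃ G : Fin r → SimpleGraph (Fin n), IsDecomp G ∧ ∏ i, β (G i) = s}

/-- Non-degenerate Nordhaus–Gaddum product upper bound `NGΠ↑ⁿ_β(r;n)`. -/
noncomputable def NGprodUpND {n : ℕ} (β : SimpleGraph (Fin n) → ℕ) (r : ℕ) : ℕ :=
  sSup {s | ∃ G : Fin r → SimpleGraph (Fin n), IsNDDecomp G ∧ ∏ i, β (G i) = s}

/-- Nordhaus–Gaddum product lower bound `NGΠ↓_β(r;n)`. -/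
noncomputable def NGprodLow {n : ℕ} (β : SimpleGraph (Fin n) → ℕ) (r : ℕ) : ℕ :=
  sInf {s | ∃ G : Fin r → SimpleGraph (Fin n), IsDecomp G ∧ ∏ i, β (G i) = s}

/-- Non-degenerate Nordhaus–Gaddum product lower bound `NGΠ↓ⁿ_β(r;n)`. -/
noncomputable def NGprodLowND {n : ℕ} (β : SimpleGraph (Fin n) → ℕ) (r : ℕ) : ℕ :=
  sInf {s | ∃ G : Fin r → SimpleGraph (Fin n), IsNDDecomp G ∧ ∏ i, β (G i) = s}

/-- The triangular root `t(r) = ⌈√(2r + 1/4) − 1/2⌉`. -/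
noncomputable def trt (r : ℕ) : ℕ := ⌈Real.sqrt (2 * (r : ℝ) + 1 / 4) - 1 / 2⌉₊

/-- `H` is a path together with isolated vertices: its edges are exactly those
of a path through some list of distinct vertices. -/
def IsPathGraph {n : ℕ} (H : SimpleGraph (Fin n)) : Prop :=
  ∃ (m : ℕ) (f : Fin (m + 1) ↪ Fin n), ∀ u v : Fin n,
    H.Adj u v ↔ ∃ a b : Fin (m + 1), (a : ℕ) + 1 = (b : ℕ) ∧
      ((u = f a ∧ v = f b) ∨ (u = f b ∧ v = f a))

end NG

namespace NG

def Ch {n : ℕ} (k : ℕ) (G : SimpleGraph (Fin n)) : Prop :=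
  ∃ (H : SimpleGraph (Fin n)) (l : Fin n → ℕ), G ≤ H ∧ Function.Injective l ∧
    (∀ v x y, l x < l v → l y < l v → H.Adj x v → H.Adj y v → x ≠ y → H.Adj x y) ∧
    ∀ v, (Finset.univ.filter (fun x => l x < l v ∧ H.Adj x v)).card ≤ k

lemma back_card_le {k N : ℕ} {H : SimpleGraph (Fin N)} (h : IsKTreeOrd k N H) (j : Fin N) :
    (backNbhd H j).card ≤ k := by
  by_cases hj : k < (j : ℕ)
  · exact (h.2.2.2 j hj).1.le
  · have : backNbhd H j ⊆ Finset.Iio j := by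
      intro x hx
      simp only [backNbhd, Finset.mem_filter, Finset.mem_univ, true_and] at hx
      exact Finset.mem_Iio.2 hx.1
    have h2 := Finset.card_le_card this
    rw [Fin.card_Iio] at h2
    omega

lemma back_clique {k N : ℕ} {H : SimpleGraph (Fin N)} (h : IsKTreeOrd k N H) (v x y : Fin N)
    (hx : (x : ℕ) < v) (hy : (y : ℕ) < v) (hxv : H.Adj x v) (hyv : H.Adj y v) (hne : x ≠ y) :
    H.Adj x y := by
  by_cases hj : k < (v : ℕ)
  · have := (h.2.2.2 v hj).2
    apply this _ _ hne
    · simp [backNbhd, hxv]; exact hx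
    · simp [backNbhd, hyv]; exact hy
  · have hne' : (x : ℕ) ≠ y := fun h => hne (Fin.ext h)
    rcases lt_or_gt_of_ne hne' with h1 | h1
    · exact h.2.2.1 x y h1 (by omega)
    · exact (h.2.2.1 y x h1 (by omega)).symm

lemma ch_of_ktree {n k N : ℕ} {G : SimpleGraph (Fin n)} {H : SimpleGraph (Fin N)}
    (f : Fin n ↪ Fin N) (h : IsKTreeOrd k N H) (hf : ∀ u v, G.Adj u v → H.Adj (f u) (f v)) :
    Ch k G := by
  refine ⟨H.comap f, fun x => (f x : ℕ), fun u v huv => hf u v huv, ?_, ?_, ?_⟩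
  · intro a b hab
    exact f.injective (Fin.ext hab)
  · intro v x y hx hy hxv hyv hne
    exact back_clique h (f v) (f x) (f y) hx hy hxv hyv (fun e => hne (f.injective e))
  · intro v
    refine le_trans ?_ (back_card_le h (f v))
    apply Finset.card_le_card_of_injOn f
    · intro x hx
      simpa [backNbhd] using hx
    · exact f.injective.injOn

lemma clique_card {n k : ℕ} {H : SimpleGraph (Fin n)} {l : Fin n → ℕ}
    (hl : Function.Injective l)
    (hk : ∀ v, (Finset.univ.filter (fun x => l x < l v ∧ H.Adj x v)).card ≤ k)
    (S : Finset (Fin n)) (hS : ∀ x ∈ S, ∀ y ∈ S, x ≠ y → H.Adj x y) : S.card ≤ k + 1 := by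
  rcases S.eq_empty_or_nonempty with rfl | hne
  · simp
  obtain ⟨v, hv, hmax⟩ := S.exists_max_image l hne
  have : S ⊆ insert v (Finset.univ.filter (fun x => l x < l v ∧ H.Adj x v)) := by
    intro x hx
    by_cases hxv : x = v
    · simp [hxv]
    · simp only [Finset.mem_insert, Finset.mem_filter, Finset.mem_univ, true_and]
      right
      exact ⟨lt_of_le_of_ne (hmax x hx) (fun e => hxv (hl e)), hS x hx v hv hxv⟩
  have h1 := Finset.card_le_card this
  have h2 := Finset.card_insert_le v (Finset.univ.filter (fun x => l x < l v ∧ H.Adj x v))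
  have := hk v
  omega

lemma ng_sum {n a b : ℕ} {G₁ G₂ : SimpleGraph (Fin n)} (h1 : Ch a G₁) (h2 : Ch b G₂)
    (hc : ∀ x y, x ≠ y → G₁.Adj x y ∨ G₂.Adj x y) : n ≤ a + b + 2 := by
  obtain ⟨H, l, hGH, hl, hs, hk⟩ := h1
  obtain ⟨H', l', hGH', hl', hs', hk'⟩ := h2
  have cov : ∀ x y, x ≠ y → ¬ H.Adj x y → H'.Adj x y := by
    intro x y hxy hn
    rcases hc x y hxy with h | h
    · exact absurd (hGH h) hn
    · exact hGH' h
  -- no induced four-cycle in H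
  have c4 : ∀ x y v w, H.Adj x v → H.Adj x w → H.Adj y v → H.Adj y w →
      x ≠ y → v ≠ w → ¬ H.Adj x y → ¬ H.Adj v w → False := by
    intro x y v w xv xw yv yw hxy hvw nxy nvw
    have key : ∀ p q s t, H.Adj p s → H.Adj p t → H.Adj q s → H.Adj q t → p ≠ q → s ≠ t →
        ¬ H.Adj p q → ¬ H.Adj s t → l q < l p → l s < l t → False := by
      intro p q s t ps pt qs qt pq st npq nst h1 h2
      rcases lt_trichotomy (l t) (l p) with h | h | h
      · exact nst (hs p s t (by omega) h ps.symm pt.symm st)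
      · exact pt.ne (hl h.symm)
      · exact npq (hs t p q h (by omega) pt qt pq)
    rcases lt_or_gt_of_ne (fun e => hxy (hl e)) with h1 | h1 <;>
      rcases lt_or_gt_of_ne (fun e => hvw (hl e)) with h2 | h2
    · exact key y x v w yv yw xv xw hxy.symm hvw (fun h => nxy h.symm) nvw h1 h2
    · exact key y x w v yw yv xw xv hxy.symm hvw.symm (fun h => nxy h.symm)
        (fun h => nvw h.symm) h1 h2
    · exact key x y v w xv xw yv yw hxy hvw nxy nvw h1 h2
    · exact key x y w v xw xv yw yv hxy hvw.symm nxy (fun h => nvw h.symm) h1 h2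
  let F : Finset (Fin n) :=
    Finset.univ.filter (fun v => ∃ w, l' v < l' w ∧ ¬ H.Adj v w)
  rcases F.eq_empty_or_nonempty with hF | hF
  · have : (Finset.univ : Finset (Fin n)).card ≤ a + 1 := by
      apply clique_card hl hk
      intro x _ y _ hxy
      by_contra hn
      rcases lt_or_gt_of_ne (fun e => hxy (hl' e)) with h | h
      · have : x ∈ F := by simp only [F, Finset.mem_filter, Finset.mem_univ, true_and]; exact ⟨y, h, hn⟩
        simp [hF] at this
      · have : y ∈ F := by
          simp only [F, Finset.mem_filter, Finset.mem_univ, true_and]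
          exact ⟨x, h, fun e => hn e.symm⟩
        simp [hF] at this
    simp at this
    omega
  obtain ⟨v, hvF, hmax⟩ := F.exists_max_image l' hF
  obtain ⟨w, hvw, nvw⟩ : ∃ w, l' v < l' w ∧ ¬ H.Adj v w := by simpa [F] using hvF
  have vnew : v ≠ w := by rintro rfl; omega
  have Avw : H'.Adj v w := cov v w vnew nvw
  let B := Finset.univ.filter (fun x => l' x < l' v ∧ H'.Adj x v)
  let C := insert v B
  have hC : C.card ≤ b + 1 := (Finset.card_insert_le _ _).trans (by have := hk' v; simp only [B]; omega)
  have key : ∀ x y, l' x < l' y → ¬ H.Adj x y → x ∉ C → y ∉ C → False := by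
    intro x y hxy nxy hxC hyC
    have hxF : x ∈ F := by
      simp only [F, Finset.mem_filter, Finset.mem_univ, true_and]; exact ⟨y, hxy, nxy⟩
    have hxney : x ≠ y := by rintro rfl; omega
    have Axy : H'.Adj x y := cov x y hxney nxy
    have C1 : ∀ z, z ∉ C → z ≠ v ∧ (l' z < l' v → ¬ H'.Adj z v) := by
      intro z hz
      simp only [C, B, Finset.mem_insert, Finset.mem_filter, Finset.mem_univ, true_and, not_or,
        not_and] at hz
      exact hz
    obtain ⟨xv, hx⟩ := C1 x hxC
    obtain ⟨yv, hy⟩ := C1 y hyC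
    have hxl : l' x < l' v := lt_of_le_of_ne (hmax x hxF) (fun e => xv (hl' e))
    have hx := hx hxl
    have xw : x ≠ w := by rintro rfl; omega
    have nxw : ¬ H'.Adj x w := fun h => hx (hs' w x v (by omega) hvw h Avw xv)
    have yw : y ≠ w := by rintro rfl; exact nxw Axy
    have nyv : ¬ H'.Adj y v := by
      intro h
      rcases lt_or_gt_of_ne (fun e => yv (hl' e)) with h1 | h1
      · exact hy h1 h
      · exact hx (hs' y x v hxy h1 Axy h.symm xv)
    have nyw : ¬ H'.Adj y w := by
      intro h
      rcases lt_or_gt_of_ne (fun e => yw (hl' e)) with h1 | h1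
      · exact nyv (hs' w y v h1 hvw h Avw yv)
      · exact nxw (hs' y x w hxy h1 Axy h.symm xw)
    have e1 : H.Adj x v := by by_contra h; exact hx (cov x v xv h)
    have e2 : H.Adj x w := by by_contra h; exact nxw (cov x w xw h)
    have e3 : H.Adj y v := by by_contra h; exact nyv (cov y v yv h)
    have e4 : H.Adj y w := by by_contra h; exact nyw (cov y w yw h)
    exact c4 x y v w e1 e2 e3 e4 hxney vnew nxy nvw
  have hD : (Cᶜ).card ≤ a + 1 := by
    apply clique_card hl hk
    intro x hx y hy hxy
    rw [Finset.mem_compl] at hx hy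
    by_contra hn
    rcases lt_or_gt_of_ne (fun e => hxy (hl' e)) with h | h
    · exact key x y h hn hx hy
    · exact key y x h (fun e => hn e.symm) hy hx
  have := Finset.card_add_card_compl C
  rw [Fintype.card_fin] at this
  omega

lemma edge_count {n k : ℕ} (hn : 0 < n) {G : SimpleGraph (Fin n)} (h : Ch k G) :
    ∑ v : Fin n, ∑ x : Fin n, (if G.Adj x v then 1 else 0) ≤ 2 * (k * (n - 1)) := by
  obtain ⟨H, l, hGH, hl, hs, hk⟩ := h
  have hA : ∑ v : Fin n, ∑ x : Fin n, (if l x < l v ∧ H.Adj x v then 1 else 0) ≤ k * (n - 1) := by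
    have : Nonempty (Fin n) := ⟨⟨0, hn⟩⟩
    obtain ⟨v0, -, hv0⟩ := (Finset.univ : Finset (Fin n)).exists_min_image l Finset.univ_nonempty
    rw [← Finset.add_sum_erase _ _ (Finset.mem_univ v0)]
    have h0 : ∑ x : Fin n, (if l x < l v0 ∧ H.Adj x v0 then 1 else 0) = 0 := by
      apply Finset.sum_eq_zero
      intro x _
      have := hv0 x (Finset.mem_univ _)
      rw [if_neg]
      omega
    rw [h0, zero_add]
    have : ∀ v ∈ (Finset.univ : Finset (Fin n)).erase v0,
        ∑ x : Fin n, (if l x < l v ∧ H.Adj x v then 1 else 0) ≤ k := by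
      intro v _
      have := hk v
      rwa [Finset.card_filter] at this
    have h2 := Finset.sum_le_card_nsmul _ _ _ this
    rw [Finset.card_erase_of_mem (Finset.mem_univ _), Finset.card_univ, Fintype.card_fin] at h2
    simp only [smul_eq_mul] at h2
    linarith [mul_comm k (n-1)]
  have hB : ∑ v : Fin n, ∑ x : Fin n, (if l v < l x ∧ H.Adj v x then 1 else 0) ≤ k * (n - 1) := by
    rw [Finset.sum_comm]; exact hA
  have : ∑ v : Fin n, ∑ x : Fin n, (if G.Adj x v then 1 else 0) ≤
      ∑ v : Fin n, ∑ x : Fin n, (if l x < l v ∧ H.Adj x v then 1 else 0) +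
      ∑ v : Fin n, ∑ x : Fin n, (if l v < l x ∧ H.Adj v x then 1 else 0) := by
    rw [← Finset.sum_add_distrib]
    apply Finset.sum_le_sum
    intro v _
    rw [← Finset.sum_add_distrib]
    apply Finset.sum_le_sum
    intro x _
    by_cases hx : G.Adj x v
    · have hH : H.Adj x v := hGH hx
      rcases lt_or_gt_of_ne (fun e => hx.ne (hl e)) with h | h
      · simp [hx, hH, h]
      · simp [hx, hH.symm, h]
    · simp [hx]
  omega

lemma half_sum {n r : ℕ} (hn : 2 ≤ n) {G : Fin r → SimpleGraph (Fin n)} (a : Fin r → ℕ)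
    (h : ∀ i, Ch (a i) (G i)) (hc : ∀ x y, x ≠ y → ∃ i, (G i).Adj x y) :
    n ≤ 2 * ∑ i, a i := by
  have h1 : ∑ i, ∑ v : Fin n, ∑ x : Fin n, (if (G i).Adj x v then 1 else 0) ≤
      ∑ i, 2 * (a i * (n - 1)) := Finset.sum_le_sum fun i _ => edge_count (by omega) (h i)
  have h2 : n * (n - 1) ≤ ∑ i, ∑ v : Fin n, ∑ x : Fin n, (if (G i).Adj x v then 1 else 0) := by
    rw [Finset.sum_comm]
    have : ∀ v ∈ (Finset.univ : Finset (Fin n)), (n - 1) ≤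
        ∑ i, ∑ x : Fin n, (if (G i).Adj x v then 1 else 0) := by
      intro v _
      rw [Finset.sum_comm]
      have e : n - 1 = ∑ x ∈ Finset.univ.erase v, 1 := by simp
      rw [e]
      refine le_trans (Finset.sum_le_sum ?_) (Finset.sum_le_sum_of_subset (Finset.erase_subset v _))
      intro x hx
      obtain ⟨i, hi⟩ := hc x v (Finset.ne_of_mem_erase hx)
      refine le_trans ?_ (Finset.single_le_sum (fun _ _ => Nat.zero_le _) (Finset.mem_univ i))
      simp [hi]
    have := Finset.card_nsmul_le_sum _ _ _ this
    simpa using this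
  rw [← Finset.mul_sum, ← Finset.sum_mul] at h1
  have h3 : n * (n - 1) ≤ (2 * ∑ i, a i) * (n - 1) := by
    rw [mul_assoc]; exact h2.trans h1
  exact Nat.le_of_mul_le_mul_right h3 (by omega)

lemma sum_le_prod {ι : Type*} (s : Finset ι) (a : ι → ℕ) (h : ∀ i, 1 ≤ a i) :
    ∑ i ∈ s, a i + 1 ≤ ∏ i ∈ s, a i + s.card := by
  induction s using Finset.induction_on with
  | empty => simp
  | insert i s hi ih =>
    rw [Finset.sum_insert hi, Finset.prod_insert hi, Finset.card_insert_of_notMem hi]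
    have h1 := h i
    have h2 : 1 ≤ ∏ i ∈ s, a i := Finset.one_le_prod' fun i _ => h i
    nlinarith

/-- power of a path -/
def PP (k N : ℕ) : SimpleGraph (Fin N) where
  Adj i j := i ≠ j ∧ (i : ℕ) ≤ j + k ∧ (j : ℕ) ≤ i + k
  symm := ⟨fun i j h => ⟨h.1.symm, h.2.2, h.2.1⟩⟩
  loopless := ⟨fun i h => h.1 rfl⟩

lemma PP_linear {k N : ℕ} (hk : 1 ≤ k) (hN : k + 1 ≤ N) : IsLinearKTreeOrd k N (PP k N) := by
  have hb : ∀ i j : Fin N, i ∈ backNbhd (PP k N) j ↔ (i : ℕ) < j ∧ (j : ℕ) ≤ i + k := by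
    intro i j
    rw [backNbhd, Finset.mem_filter]
    constructor
    · rintro ⟨_, h1, h2, h3, h4⟩; exact ⟨h1, h4⟩
    · rintro ⟨h1, h2⟩; exact ⟨Finset.mem_univ _, h1, fun e => by subst e; omega, by omega, h2⟩
  refine ⟨⟨hk, hN, ?_, ?_⟩, ?_⟩
  · intro i j h1 h2
    exact ⟨fun e => by subst e; omega, by omega, by omega⟩
  · intro j hj
    constructor
    · have : backNbhd (PP k N) j = Finset.Ico (⟨(j : ℕ) - k, by omega⟩ : Fin N) j := by
        ext i
        rw [hb, Finset.mem_Ico, Fin.le_def, Fin.lt_def]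
        simp only
        omega
      rw [this, Fin.card_Ico]
      simp only
      omega
    · intro x hx y hy hne
      rw [Finset.mem_coe, hb] at hx hy
      exact ⟨hne, by omega, by omega⟩
  · intro i j h1 h2
    rw [hb]
    omega

lemma lin_cat {k N : ℕ} {H : SimpleGraph (Fin N)} (h : IsLinearKTreeOrd k N H) :
    IsCaterpillarOrd k N H := by
  refine ⟨h.1, ?_⟩
  intro i j hij hj x hx
  have hi := h.2 i j hij hj
  by_cases e : x = i
  · simp [e]
  · simp only [backNbhd, Finset.mem_filter, Finset.mem_univ, true_and] at hx hi
    have : (x : ℕ) ≠ i := fun h => e (Fin.ext h)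
    simp only [backNbhd, Finset.mem_insert, Finset.mem_filter, Finset.mem_univ, true_and]
    right
    exact ⟨by omega, back_clique h.1 j x i hx.1 hi.1 hx.2 hi.2 e⟩

lemma lin_two {k N : ℕ} {H : SimpleGraph (Fin N)} (h : IsLinearKTreeOrd k N H) :
    IsTwoSidedKTreeOrd k N H := by
  refine ⟨h.1, ?_⟩
  intro j hj
  left
  obtain ⟨hk, hN, hcl, hbk⟩ := h.1
  by_cases e : (j : ℕ) = k + 1
  · have hc := (hbk j hj).1
    obtain ⟨u, hu⟩ := Finset.card_pos.1 (show 0 < (backNbhd H j).card by omega)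
    refine ⟨u, hu, ?_⟩
    simp only [backNbhd, Finset.mem_filter, Finset.mem_univ, true_and] at hu
    have : (Finset.univ.filter (fun w : Fin N => (w : ℕ) < j ∧ (u : ℕ) < j ∧ H.Adj u w))
        = (Finset.Iio j).erase u := by
      ext w
      simp only [Finset.mem_filter, Finset.mem_univ, true_and, Finset.mem_erase, Finset.mem_Iio,
        Fin.lt_def]
      constructor
      · rintro ⟨h1, h2, h3⟩; exact ⟨h3.ne', h1⟩
      · rintro ⟨h1, h2⟩
        refine ⟨h2, hu.1, ?_⟩
        have h3 : (w : ℕ) ≠ u := fun h => h1 (Fin.ext h)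
        rcases lt_or_gt_of_ne h3 with h4 | h4
        · exact (hcl w u h4 (by omega)).symm
        · exact hcl u w h4 (by omega)
    rw [stageDeg, this, Finset.card_erase_of_mem (Finset.mem_Iio.2 (Fin.lt_def.2 hu.1)), Fin.card_Iio]
    omega
  · let u : Fin N := ⟨(j : ℕ) - 1, by omega⟩
    have huv : (u : ℕ) = j - 1 := rfl
    refine ⟨u, h.2 u j (by omega) (by omega), ?_⟩
    rw [← (hbk u (by omega)).1, stageDeg, backNbhd]
    congr 1
    ext w
    simp only [Finset.mem_filter, Finset.mem_univ, true_and]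
    constructor
    · rintro ⟨h1, h2, h3⟩
      have : (w : ℕ) ≠ u := fun h => h3.ne' (Fin.ext h)
      exact ⟨by omega, h3.symm⟩
    · rintro ⟨h1, h2⟩
      exact ⟨by omega, by omega, h2.symm⟩

section main
variable {P : ℕ → (N : ℕ) → SimpleGraph (Fin N) → Prop}

lemma width_le (hL : ∀ k N H, IsLinearKTreeOrd k N H → P k N H) {n k N : ℕ}
    {G : SimpleGraph (Fin n)} (f : Fin n ↪ Fin N) (hk : 1 ≤ k) (hN : k + 1 ≤ N)
    (hf : ∀ u v, G.Adj u v → (PP k N).Adj (f u) (f v)) : widthParam P n G ≤ k := by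
  rw [widthParam]
  split_ifs
  · omega
  · exact Nat.sInf_le ⟨N, PP k N, f, hL _ _ _ (PP_linear hk hN), hf⟩

lemma width_spec (hL : ∀ k N H, IsLinearKTreeOrd k N H → P k N H)
    (hT : ∀ k N H, P k N H → IsKTreeOrd k N H) {n : ℕ} (hn : 2 ≤ n)
    {G : SimpleGraph (Fin n)} (hG : G ≠ ⊥) :
    1 ≤ widthParam P n G ∧ Ch (widthParam P n G) G := by
  rw [widthParam, if_neg hG]
  have hne : {k | ∃ (N : ℕ) (H : SimpleGraph (Fin N)) (f : Fin n ↪ Fin N),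
    P k N H ∧ ∀ u v : Fin n, G.Adj u v → H.Adj (f u) (f v)}.Nonempty :=
    ⟨n - 1, n, PP (n-1) n, Function.Embedding.refl _, hL _ _ _ (PP_linear (by omega) (by omega)),
      fun u v huv => ⟨huv.ne, by simp only [Function.Embedding.refl_apply]; omega,
        by simp only [Function.Embedding.refl_apply]; omega⟩⟩
  obtain ⟨N, H, f, hP, hf⟩ := Nat.sInf_mem hne
  exact ⟨(hT _ _ _ hP).1, ch_of_ktree f (hT _ _ _ hP) hf⟩

/-- the extremal decomposition, `s + 1` parts -/
def Ex (n s : ℕ) (i : Fin (s + 1)) : SimpleGraph (Fin n) where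
  Adj a b := a ≠ b ∧
    (((i : ℕ) < s ∧ n - 2 * s + 2 * i ≤ ((a : ℕ) - b + (b - a)) ∧
      ((a : ℕ) - b + (b - a)) ≤ n - 2 * s + 2 * i + 1) ∨
    ((i : ℕ) = s ∧ ((a : ℕ) - b + (b - a)) < n - 2 * s))
  symm := ⟨fun a b h => ⟨h.1.symm, by have := h.2; omega⟩⟩
  loopless := ⟨fun i h => h.1 rfl⟩

lemma ex_nd {n s : ℕ} (hs : 1 ≤ s) (hn : 4 * s ≤ n) : IsNDDecomp (Ex n s) := by
  refine ⟨⟨?_, ?_⟩, ?_⟩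
  · intro i j hij
    rw [disjoint_iff_inf_le]
    intro a b hab
    have hij' : (i : ℕ) ≠ j := fun h => hij (Fin.ext h)
    obtain ⟨h1, h2⟩ := hab
    have h1 := h1.2
    have h2 := h2.2
    exfalso
    omega
  · rw [eq_top_iff]
    intro a b hab
    have hab : a ≠ b := hab
    rw [SimpleGraph.iSup_adj]
    by_cases h : ((a : ℕ) - b + (b - a)) < n - 2 * s
    · exact ⟨⟨s, by omega⟩, hab, Or.inr ⟨rfl, h⟩⟩
    · refine ⟨⟨((a : ℕ) - b + (b - a) - (n - 2 * s)) / 2, by omega⟩, hab, Or.inl ?_⟩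
      simp only
      omega
  · intro i h
    have hi := i.2
    by_cases e : (i : ℕ) < s
    · have : (Ex n s i).Adj ⟨0, by omega⟩ ⟨n - 2 * s + 2 * i, by omega⟩ := by
        refine ⟨?_, Or.inl ?_⟩
        · intro h; simp only [Fin.mk.injEq] at h; omega
        · simp only; omega
      rw [h] at this
      exact this
    · have : (Ex n s i).Adj ⟨0, by omega⟩ ⟨1, by omega⟩ := by
        refine ⟨?_, Or.inr ?_⟩
        · intro h; simp only [Fin.mk.injEq] at h; omega
        · simp only; omega
      rw [h] at this
      exact this

lemma ex_path (hL : ∀ k N H, IsLinearKTreeOrd k N H → P k N H) {n s : ℕ}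
    (hn : 4 * s ≤ n) (i : Fin (s + 1)) (hi : (i : ℕ) < s) : widthParam P n (Ex n s i) ≤ 1 := by
  let D := n - 2 * s + 2 * i
  have hD : D = n - 2 * s + 2 * i := rfl
  let g : Fin n → Fin (2 * n + 2) := fun v =>
    ⟨if (v : ℕ) < D then 2 * v + 1 else 2 * (v - D), by split_ifs <;> omega⟩
  have hg : Function.Injective g := by
    intro a b hab
    simp only [g, Fin.mk.injEq] at hab
    apply Fin.ext
    split_ifs at hab <;> omega
  refine width_le hL (N := 2 * n + 2) ⟨g, hg⟩ le_rfl (by omega) ?_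
  intro u v huv
  refine ⟨fun e => huv.1 (hg e), ?_⟩
  have h := huv.2
  simp only [Function.Embedding.coeFn_mk, g]
  split_ifs <;> omega

lemma ex_big (hL : ∀ k N H, IsLinearKTreeOrd k N H → P k N H) {n s : ℕ} (hs : 1 ≤ s)
    (hn : 4 * s ≤ n) (i : Fin (s + 1)) (hi : (i : ℕ) = s) :
    widthParam P n (Ex n s i) ≤ n - 2 * s - 1 := by
  refine width_le hL (Function.Embedding.refl _) (by omega) (by omega) ?_
  intro u v huv
  have h := huv.2
  refine ⟨huv.1, ?_, ?_⟩ <;> simp only [Function.Embedding.refl_apply] <;> omega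

lemma upper (hL : ∀ k N H, IsLinearKTreeOrd k N H → P k N H) {n s : ℕ} (hs : 1 ≤ s)
    (hn : 4 * s ≤ n) : NGprodLowND (widthParam P n) (s + 1) ≤ n - 2 * s - 1 := by
  have h0 : NGprodLowND (widthParam P n) (s + 1) ≤ ∏ i, widthParam P n (Ex n s i) :=
    Nat.sInf_le ⟨Ex n s, ex_nd hs hn, rfl⟩
  refine h0.trans ?_
  rw [Fin.prod_univ_castSucc]
  have h1 : ∏ i : Fin s, widthParam P n (Ex n s i.castSucc) ≤ 1 :=
    Finset.prod_le_one' fun i _ => ex_path hL hn _ (by simp)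
  have h2 := ex_big hL hs hn (Fin.last s) (by simp)
  calc _ ≤ 1 * (n - 2 * s - 1) := Nat.mul_le_mul h1 h2
    _ = _ := one_mul _

lemma lower {n s m : ℕ} (hs : 1 ≤ s) (hn : 4 * s ≤ n)
    (h : ∀ G : Fin (s + 1) → SimpleGraph (Fin n), IsNDDecomp G →
      m ≤ ∏ i, widthParam P n (G i)) : m ≤ NGprodLowND (widthParam P n) (s + 1) := by
  apply le_csInf
  · exact ⟨_, Ex n s, ex_nd hs hn, rfl⟩
  · rintro _ ⟨G, hG, rfl⟩
    exact h G hG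

lemma cover {n r : ℕ} {G : Fin r → SimpleGraph (Fin n)} (h : IsNDDecomp G) (x y : Fin n)
    (hxy : x ≠ y) : ∃ i, (G i).Adj x y := by
  have : (⨆ i, G i).Adj x y := by rw [h.1.2]; exact hxy
  rwa [SimpleGraph.iSup_adj] at this

lemma main (hL : ∀ k N H, IsLinearKTreeOrd k N H → P k N H)
    (hT : ∀ k N H, P k N H → IsKTreeOrd k N H) :
    (∀ n : ℕ, 4 ≤ n → NGprodLowND (widthParam P n) 2 = n - 3) ∧
    (∀ r : ℕ, 3 ≤ r → ∀ᶠ n : ℕ in Filter.atTop,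
      ((n : ℝ) / 2 - r + 1 ≤ (NGprodLowND (widthParam P n) r : ℝ)) ∧
      ((NGprodLowND (widthParam P n) r : ℝ) ≤ (n : ℝ) - 2 * r + 1)) := by
  constructor
  · intro n hn
    apply le_antisymm
    · have := upper hL (n := n) (s := 1) le_rfl (by omega)
      exact this.trans (by omega)
    · apply lower (s := 1) le_rfl (by omega)
      intro G hG
      have h0 := width_spec hL hT (by omega) (hG.2 0)
      have h1 := width_spec hL hT (by omega) (hG.2 1)
      have h2 := ng_sum h0.2 h1.2 (by
        intro x y hxy
        obtain ⟨i, hi⟩ := cover hG x y hxy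
        fin_cases i
        · exact Or.inl hi
        · exact Or.inr hi)
      have h3 := sum_le_prod (Finset.univ : Finset (Fin 2)) (fun i => widthParam P n (G i))
        (fun i => (width_spec hL hT (by omega) (hG.2 i)).1)
      rw [Fin.sum_univ_two, Finset.card_univ, Fintype.card_fin] at h3
      have h4 : n - 3 ≤ ∏ i : Fin 2, widthParam P n (G i) := by omega
      exact h4
  · intro r hr
    obtain ⟨s, rfl⟩ : ∃ s, r = s + 1 := ⟨r - 1, by omega⟩
    filter_upwards [Filter.eventually_ge_atTop (4 * s)] with n hn
    constructor
    · have h : n - 2 * s ≤ 2 * NGprodLowND (widthParam P n) (s + 1) := by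
        have : (n - 2 * s + 1) / 2 ≤ NGprodLowND (widthParam P n) (s + 1) := by
          apply lower (by omega) hn
          intro G hG
          have h1 := half_sum (by omega) (fun i => widthParam P n (G i))
            (fun i => (width_spec hL hT (by omega) (hG.2 i)).2) (cover hG)
          have h3 := sum_le_prod (Finset.univ : Finset (Fin (s + 1)))
            (fun i => widthParam P n (G i))
            (fun i => (width_spec hL hT (by omega) (hG.2 i)).1)
          rw [Finset.card_univ, Fintype.card_fin] at h3
          omega
        omega
      have h' : n ≤ 2 * NGprodLowND (widthParam P n) (s + 1) + 2 * s := by omega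
      have h'' : (n : ℝ) ≤ 2 * (NGprodLowND (widthParam P n) (s + 1) : ℝ) + 2 * s := by
        exact_mod_cast h'
      push_cast
      linarith
    · have := upper hL (n := n) (s := s) (by omega) hn
      have h' : NGprodLowND (widthParam P n) (s + 1) + 2 * s + 1 ≤ n := by omega
      have h'' : (NGprodLowND (widthParam P n) (s + 1) : ℝ) + 2 * s + 1 ≤ n := by
        exact_mod_cast h'
      push_cast
      linarith

end main
end NG

/-- For `β ∈ {tw, la, pw, ppw}`: (i) `NGΠ↓ⁿ_β(2;n) = n − 3` for all `n ≥ 4`;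
(ii) for fixed `r ≥ 3` and all sufficiently large `n`,
`n/2 − r + 1 ≤ NGΠ↓ⁿ_β(r;n) ≤ n − 2r + 1`. -/
theorem statement16 (β : (n : ℕ) → SimpleGraph (Fin n) → ℕ)
    (hβ : β = NG.treewidth ∨ β = NG.la ∨ β = NG.pw ∨ β = NG.ppw) :
    (∀ n : ℕ, 4 ≤ n → NG.NGprodLowND (β n) 2 = n - 3) ∧
    (∀ r : ℕ, 3 ≤ r → ∀ᶠ n : ℕ in Filter.atTop,
      ((n : ℝ) / 2 - r + 1 ≤ (NG.NGprodLowND (β n) r : ℝ)) ∧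
      ((NG.NGprodLowND (β n) r : ℝ) ≤ (n : ℝ) - 2 * r + 1)) := by 
  rcases hβ with rfl | rfl | rfl | rfl
  · exact NG.main (P := NG.IsKTreeOrd) (fun k N H h => h.1) (fun k N H h => h)
  · exact NG.main (P := NG.IsTwoSidedKTreeOrd) (fun k N H h => NG.lin_two h) (fun k N H h => h.1)
  · exact NG.main (P := NG.IsCaterpillarOrd) (fun k N H h => NG.lin_cat h) (fun k N H h => h.1)
  · exact NG.main (P := NG.IsLinearKTreeOrd) (fun k N H h => h) (fun k N H h => h.1)
end

section
/- For all integers r ≥ 2 and n ≥ 1, (0.513)^{r−2}·n ≤ NGΠ↓_η(r;n) ≤ n. -/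
open scoped Classical

set_option linter.unusedSectionVars false
set_option linter.unnecessarySimpa false
set_option linter.unusedVariables false


namespace HW
variable {V : Type*}

def Conn (G : SimpleGraph V) (S : Finset V) : Prop := (G.induce (S : Set V)).Connected

lemma Conn.nonempty {G : SimpleGraph V} {S : Finset V} (h : Conn G S) : S.Nonempty := by
  obtain ⟨⟨x, hx⟩⟩ := SimpleGraph.Connected.nonempty h
  exact ⟨x, by simpa using hx⟩

lemma Conn.cross {G : SimpleGraph V} {S : Finset V} (h : Conn G S) (A : V → Prop)
    {a b : V} (ha : a ∈ S) (hA : A a) (hb : b ∈ S) (hB : ¬ A b) :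
    ∃ u ∈ S, ∃ v ∈ S, A u ∧ ¬ A v ∧ G.Adj u v := by
  obtain ⟨p⟩ := h.preconnected ⟨a, by simpa using ha⟩ ⟨b, by simpa using hb⟩
  obtain ⟨d, -, h1, h2⟩ := p.exists_boundary_dart {x | A x.1} hA hB
  exact ⟨d.fst.1, by simpa using d.fst.2, d.snd.1, by simpa using d.snd.2, h1, h2, d.adj⟩

lemma conn_of_cross {G : SimpleGraph V} {S : Finset V} (hS : S.Nonempty)
    (h : ∀ A : V → Prop, ∀ a ∈ S, A a → ∀ b ∈ S, ¬ A b →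
      ∃ u ∈ S, ∃ v ∈ S, A u ∧ ¬ A v ∧ G.Adj u v) : Conn G S := by
  obtain ⟨x, hx⟩ := hS
  refine (SimpleGraph.connected_iff _).2 ⟨?_, ⟨⟨x, by simpa using hx⟩⟩⟩
  intro a b
  by_contra hab
  obtain ⟨u, hu, v, hv, ⟨hu', hau⟩, hv', huv⟩ := h (fun y => ∃ hy : y ∈ (S : Set V),
    (G.induce (S : Set V)).Reachable a ⟨y, hy⟩) a.1 (by simpa using a.2) ⟨a.2, SimpleGraph.Reachable.refl _⟩
    b.1 (by simpa using b.2) (by rintro ⟨_, hb⟩; exact hab hb)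
  apply hv'
  refine ⟨by simpa using hv, hau.trans (SimpleGraph.Adj.reachable ?_)⟩
  simpa using huv

lemma conn_singleton (G : SimpleGraph V) (v : V) : Conn G {v} := by
  apply conn_of_cross ⟨v, by simp⟩
  intro A a ha hA b hb hB
  simp at ha hb; subst ha; subst hb; exact absurd hA hB

lemma Conn.mono {G H : SimpleGraph V} {S : Finset V} (h : Conn G S)
    (hGH : ∀ u ∈ S, ∀ v ∈ S, G.Adj u v → H.Adj u v) : Conn H S := by
  apply conn_of_cross h.nonempty
  intro A a ha hA b hb hB
  obtain ⟨u, hu, v, hv, h1, h2, h3⟩ := h.cross A ha hA hb hB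
  exact ⟨u, hu, v, hv, h1, h2, hGH u hu v hv h3⟩

variable [DecidableEq V]

/-- union over adjacency -/
lemma Conn.union {G : SimpleGraph V} {S T : Finset V} (hS : Conn G S) (hT : Conn G T)
    {s t : V} (hs : s ∈ S) (ht : t ∈ T) (hst : G.Adj s t ∨ s = t) : Conn G (S ∪ T) := by
  apply conn_of_cross ⟨s, by simp [hs]⟩
  intro A a ha hA b hb hB
  by_cases h1 : ∃ x ∈ S, ∃ y ∈ S, A x ∧ ¬ A y
  · obtain ⟨x, hx, y, hy, hAx, hAy⟩ := h1
    obtain ⟨u, hu, v, hv, h1, h2, h3⟩ := hS.cross A hx hAx hy hAy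
    exact ⟨u, by simp [hu], v, by simp [hv], h1, h2, h3⟩
  by_cases h2 : ∃ x ∈ T, ∃ y ∈ T, A x ∧ ¬ A y
  · obtain ⟨x, hx, y, hy, hAx, hAy⟩ := h2
    obtain ⟨u, hu, v, hv, h1, h2, h3⟩ := hT.cross A hx hAx hy hAy
    exact ⟨u, by simp [hu], v, by simp [hv], h1, h2, h3⟩
  push Not at h1 h2
  by_cases hAs : A s <;> by_cases hAt : A t
  · exfalso
    rcases Finset.mem_union.1 hb with hb | hb
    · exact hB (h1 s hs b hb hAs)
    · exact hB (h2 t ht b hb hAt)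
  · rcases hst with hst | rfl
    · exact ⟨s, by simp [hs], t, by simp [ht], hAs, hAt, hst⟩
    · exact absurd hAs hAt
  · rcases hst with hst | rfl
    · exact ⟨t, by simp [ht], s, by simp [hs], hAt, hAs, hst.symm⟩
    · exact absurd hAt hAs
  · exfalso
    rcases Finset.mem_union.1 ha with ha | ha
    · exact hAs (h1 a ha s hs hA)
    · exact hAt (h2 a ha t ht hA)

lemma Conn.insert {G : SimpleGraph V} {S : Finset V} (hS : Conn G S) {s t : V} (hs : s ∈ S)
    (h : G.Adj s t) : Conn G (insert t S) := by
  have := hS.union (conn_singleton G t) hs (by simp) (Or.inl h)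
  rwa [Finset.union_comm] at this

/-- attach a set of vertices each having a neighbour in the connected set. -/
lemma Conn.attach {G : SimpleGraph V} {S T : Finset V} (hS : Conn G S)
    (h : ∀ t ∈ T, ∃ s ∈ S, G.Adj s t) : Conn G (S ∪ T) := by
  induction T using Finset.induction_on with
  | empty => simpa using hS
  | insert a T ha ih =>
    rw [Finset.union_insert]
    obtain ⟨s, hs, hst⟩ := h a (by simp)
    exact Conn.insert (ih fun t ht => h t (by simp [ht])) (by simp [hs]) hst

/-- Any connected set lies in a maximal one inside X. -/
lemma exists_comp (G : SimpleGraph V) {X : Finset V} {v : V} (hv : v ∈ X) :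
    ∃ Y ⊆ X, v ∈ Y ∧ Conn G Y ∧ ∀ u ∈ Y, ∀ w ∈ X, w ∉ Y → ¬ G.Adj u w := by
  let F := X.powerset.filter (fun Y => v ∈ Y ∧ Conn G Y)
  have hF : F.Nonempty := ⟨{v}, by simp [F, hv, conn_singleton]⟩
  obtain ⟨Y, hY, hmax⟩ := F.exists_max_image Finset.card hF
  simp only [F, Finset.mem_filter, Finset.mem_powerset] at hY hmax
  refine ⟨Y, hY.1, hY.2.1, hY.2.2, fun u hu w hw hwY huw => ?_⟩
  have := hmax (Insert.insert w Y) ⟨by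
    intro x hx
    rcases Finset.mem_insert.1 hx with rfl | hx
    · exact hw
    · exact hY.1 hx, by simp [hY.2.1], hY.2.2.insert hu huw⟩
  rw [Finset.card_insert_of_notMem hwY] at this
  omega

/-- clique-minor model inside X -/
def Model (G : SimpleGraph V) (X : Finset V) {ι : Type*} (B : ι → Finset V) : Prop :=
  (∀ p, B p ⊆ X) ∧ (∀ p, Conn G (B p)) ∧ (∀ p q, p ≠ q → Disjoint (B p) (B q)) ∧
  (∀ p q, p ≠ q → ∃ u ∈ B p, ∃ v ∈ B q, G.Adj u v)

def CM (G : SimpleGraph V) (X : Finset V) (m : ℕ) : Prop := ∃ B : Fin m → Finset V, Model G X B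

noncomputable def eta (G : SimpleGraph V) (X : Finset V) : ℕ := sSup {m | CM G X m}

lemma Model.card_le {G : SimpleGraph V} {X : Finset V} {ι : Type*} [Fintype ι] {B : ι → Finset V}
    (h : Model G X B) : Fintype.card ι ≤ X.card := by
  obtain ⟨h1, h2, h3, h4⟩ := h
  choose f hf using fun p => (h2 p).nonempty
  rw [← Finset.card_univ]
  apply Finset.card_le_card_of_injOn f (fun p _ => h1 p (hf p))
  intro p _ q _ hpq
  by_contra hne
  exact (Finset.disjoint_left.1 (h3 p q hne)) (hf p) (hpq ▸ hf q)

lemma CM.le {G : SimpleGraph V} {X : Finset V} {m : ℕ} (h : CM G X m) : m ≤ X.card := by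
  obtain ⟨B, hB⟩ := h
  simpa using hB.card_le

lemma cm_zero (G : SimpleGraph V) (X : Finset V) : CM G X 0 :=
  ⟨fun p => p.elim0, fun p => p.elim0, fun p => p.elim0, fun p => p.elim0, fun p => p.elim0⟩

lemma cm_eta (G : SimpleGraph V) (X : Finset V) : CM G X (eta G X) :=
  Nat.sSup_mem (s := {m | CM G X m}) ⟨0, cm_zero G X⟩ ⟨X.card, fun _ h => CM.le h⟩

lemma CM.le_eta {G : SimpleGraph V} {X : Finset V} {m : ℕ} (h : CM G X m) : m ≤ eta G X :=
  le_csSup ⟨X.card, fun _ h => CM.le h⟩ h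

lemma Model.le_eta {G : SimpleGraph V} {X : Finset V} {ι : Type*} [Fintype ι] {B : ι → Finset V}
    (h : Model G X B) : Fintype.card ι ≤ eta G X := by
  apply CM.le_eta
  let e := (Fintype.equivFin ι).symm
  obtain ⟨h1, h2, h3, h4⟩ := h
  exact ⟨fun p => B (e p), fun p => h1 _, fun p => h2 _, fun p q hpq => h3 _ _ (by simpa using hpq),
    fun p q hpq => h4 _ _ (by simpa using hpq)⟩

lemma eta_le_card (G : SimpleGraph V) (X : Finset V) : eta G X ≤ X.card := (cm_eta G X).le

lemma eta_mono {G H : SimpleGraph V} {X Y : Finset V} (hXY : X ⊆ Y)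
    (hGH : ∀ u ∈ X, ∀ v ∈ X, G.Adj u v → H.Adj u v) : eta G X ≤ eta H Y := by
  obtain ⟨B, h1, h2, h3, h4⟩ := cm_eta G X
  apply CM.le_eta
  refine ⟨B, fun p => (h1 p).trans hXY, fun p => (h2 p).mono
    fun u hu v hv => hGH u (h1 p hu) v (h1 p hv), h3, fun p q hpq => ?_⟩
  obtain ⟨u, hu, v, hv, huv⟩ := h4 p q hpq
  exact ⟨u, hu, v, hv, hGH u (h1 p hu) v (h1 q hv) huv⟩

lemma eta_mono_set (G : SimpleGraph V) {X Y : Finset V} (hXY : X ⊆ Y) : eta G X ≤ eta G Y :=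
  eta_mono hXY fun _ _ _ _ h => h

lemma clique_le_eta {G : SimpleGraph V} {X K : Finset V} (hK : K ⊆ X)
    (h : ∀ u ∈ K, ∀ v ∈ K, u ≠ v → G.Adj u v) : K.card ≤ eta G X := by
  have : Model G X (fun p : K => ({p.1} : Finset V)) := by
    refine ⟨fun p => by simpa using hK p.2, fun p => conn_singleton _ _, fun p q hpq => ?_, fun p q hpq => ?_⟩
    · simpa using fun h => hpq (Subtype.ext h)
    · exact ⟨p.1, by simp, q.1, by simp, h _ p.2 _ q.2 fun h => hpq (Subtype.ext h)⟩
  simpa using this.le_eta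

lemma one_le_eta (G : SimpleGraph V) {X : Finset V} (hX : X.Nonempty) : 1 ≤ eta G X := by
  obtain ⟨x, hx⟩ := hX
  simpa using clique_le_eta (G := G) (X := X) (K := {x}) (by simpa using hx) (by
    intro u hu v hv h; simp at hu hv; subst hu; subst hv; exact absurd rfl h)

lemma two_le_eta {G : SimpleGraph V} {X : Finset V} {x y : V} (hx : x ∈ X) (hy : y ∈ X)
    (h : G.Adj x y) : 2 ≤ eta G X := by
  have := clique_le_eta (G := G) (X := X) (K := {x, y}) (by
    intro z hz; simp at hz; rcases hz with rfl | rfl <;> assumption) (by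
    intro u hu v hv huv
    simp at hu hv
    rcases hu with rfl | rfl <;> rcases hv with rfl | rfl
    · exact absurd rfl huv
    · exact h
    · exact h.symm
    · exact absurd rfl huv)
  rwa [Finset.card_pair h.ne] at this

/-- sets D whose removal decreases eta -/
def Good (G : SimpleGraph V) (X D : Finset V) : Prop :=
  D ⊆ X ∧ ∀ x ∈ X, ∃ D' ⊆ D, Conn G D' ∧ ∀ T ⊆ X, Conn G T → x ∈ T → ∀ y ∈ T, y ∉ D →
    ∃ d ∈ D', G.Adj d y

lemma good_of_dom {G : SimpleGraph V} {X D : Finset V} (hD : D ⊆ X) (hc : Conn G D)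
    (h : ∀ y ∈ X, y ∉ D → ∃ d ∈ D, G.Adj d y) : Good G X D :=
  ⟨hD, fun _ _ => ⟨D, subset_rfl, hc, fun _ hT _ _ y hy hyD => h y (hT hy) hyD⟩⟩

lemma Good.eta {G : SimpleGraph V} {X D : Finset V} (hX : X.Nonempty) (h : Good G X D) :
    1 + eta G (X \ D) ≤ eta G X := by
  obtain ⟨hDX, h⟩ := h
  rcases Nat.eq_zero_or_pos (HW.eta G (X \ D)) with h0 | h0
  · rw [h0]; exact one_le_eta G hX
  obtain ⟨B, h1, h2, h3, h4⟩ := cm_eta G (X \ D)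
  let p0 : Fin (HW.eta G (X \ D)) := ⟨0, h0⟩
  obtain ⟨x, hx⟩ := (h2 p0).nonempty
  have hxX := (Finset.mem_sdiff.1 (h1 p0 hx)).1
  obtain ⟨D', hD', hD'c, hD'd⟩ := h x hxX
  have hB : ∀ p, B p ⊆ X := fun p => (h1 p).trans Finset.sdiff_subset
  have key : ∀ p, ∃ u ∈ D', ∃ v ∈ B p, G.Adj u v := by
    intro p
    by_cases hp : p0 = p
    · subst hp
      obtain ⟨d, hd, hdy⟩ := hD'd (B p0) (hB _) (h2 _) hx x hx (Finset.mem_sdiff.1 (h1 _ hx)).2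
      exact ⟨d, hd, x, hx, hdy⟩
    · obtain ⟨u, hu, v, hv, huv⟩ := h4 p0 p hp
      obtain ⟨d, hd, hdy⟩ := hD'd (B p0 ∪ B p) (Finset.union_subset (hB _) (hB _))
        ((h2 _).union (h2 _) hu hv (Or.inl huv)) (by simp [hx]) v (by simp [hv])
        (Finset.mem_sdiff.1 (h1 _ hv)).2
      exact ⟨d, hd, v, hv, hdy⟩
  have hdis : ∀ p, Disjoint D' (B p) := by
    intro p
    rw [Finset.disjoint_left]
    intro a ha hb
    exact (Finset.mem_sdiff.1 (h1 p hb)).2 (hD' ha)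
  have hm : Model G X (fun o : Option (Fin (HW.eta G (X \ D))) => o.elim D' B) := by
    refine ⟨?_, ?_, ?_, ?_⟩
    · rintro (_ | p)
      · exact hD'.trans hDX
      · exact hB p
    · rintro (_ | p)
      · exact hD'c
      · exact h2 p
    · rintro (_ | p) (_ | q) hpq
      · exact absurd rfl hpq
      · exact hdis q
      · exact (hdis p).symm
      · exact h3 p q (by simpa using hpq)
    · rintro (_ | p) (_ | q) hpq
      · exact absurd rfl hpq
      · exact key q
      · obtain ⟨u, hu, v, hv, huv⟩ := key p
        exact ⟨v, hv, u, hu, huv.symm⟩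
      · exact h4 p q (by simpa using hpq)
  have := hm.le_eta
  simp at this
  omega

end HW


namespace HW
variable {V : Type*} [DecidableEq V]

lemma two_core {A B : SimpleGraph V} {X : Finset V}
    (hAB : ∀ u ∈ X, ∀ v ∈ X, u ≠ v → (A.Adj u v ↔ ¬ B.Adj u v)) (hX : X.Nonempty) {d : ℕ}
    (hA : ∀ S ⊆ X, Conn A S → S.card < d → ∃ y ∈ X, y ∉ S ∧ ∀ s ∈ S, B.Adj s y)
    (hB : ∀ S ⊆ X, Conn B S → S.card < d → ∃ y ∈ X, y ∉ S ∧ ∀ s ∈ S, A.Adj s y) :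
    d ≤ eta B X := by
  rcases Nat.lt_or_ge d 2 with hd | hd
  · exact (by omega : d ≤ 1).trans (one_le_eta B hX)
  obtain ⟨x0, hx0⟩ := hX
  rcases Nat.lt_or_ge d 3 with hd3 | hd3
  · obtain rfl : d = 2 := by omega
    obtain ⟨y, hy, -, hxy⟩ := hA {x0} (by simpa using hx0) (conn_singleton _ _) (by simp)
    exact two_le_eta hx0 hy (hxy x0 (by simp))
  have step : ∀ k, k + 1 ≤ d - 1 → ∃ K ⊆ X, K.card = k + 1 ∧ Conn B K ∧
      ∀ u ∈ K, ∀ v ∈ K, u ≠ v → B.Adj u v := by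
    intro k
    induction k with
    | zero =>
      intro _
      refine ⟨{x0}, by simpa using hx0, by simp, conn_singleton _ _, ?_⟩
      intro u hu v hv h; simp at hu hv; subst hu; subst hv; exact absurd rfl h
    | succ k ih =>
      intro hk
      obtain ⟨K, hKX, hKc, hKconn, hKq⟩ := ih (by omega)
      obtain ⟨y', hy', hy'K, hy'A⟩ := hB K hKX hKconn (by omega)
      have hconn : Conn A ({y'} ∪ K) := (conn_singleton A y').attach
        fun t ht => ⟨y', by simp, (hy'A t ht).symm⟩
      obtain ⟨y, hy, hyK, hyB⟩ := hA ({y'} ∪ K) (Finset.union_subset (by simpa using hy') hKX) hconn (by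
        have := Finset.card_union_le {y'} K
        simp at this
        simp; omega)
      have hyK' : y ∉ K := fun h => hyK (by simp [h])
      obtain ⟨k0, hk0⟩ := hKconn.nonempty
      refine ⟨insert y K, Finset.insert_subset hy hKX, by rw [Finset.card_insert_of_notMem hyK', hKc],
        hKconn.insert hk0 (hyB k0 (by simp [hk0])), ?_⟩
      intro u hu v hv huv
      rcases Finset.mem_insert.1 hu with rfl | hu <;> rcases Finset.mem_insert.1 hv with rfl | hv
      · exact absurd rfl huv
      · exact (hyB v (by simp [hv])).symm
      · exact hyB u (by simp only [Finset.mem_union]; exact Or.inr (by assumption))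
      · exact hKq u hu v hv huv
  obtain ⟨K, hKX, hKc, hKconn, hKq⟩ := step (d - 2) (by omega)
  obtain ⟨v1, hv1⟩ := hKconn.nonempty
  obtain ⟨u, hu, huK, huA⟩ := hB K hKX hKconn (by omega)
  have hTc : Conn A ({u} ∪ K.erase v1) := (conn_singleton A u).attach
    fun t ht => ⟨u, by simp, (huA t (Finset.mem_of_mem_erase ht)).symm⟩
  obtain ⟨z, hz, hzT, hzB⟩ := hA ({u} ∪ K.erase v1) (Finset.union_subset (by simpa using hu)
    ((Finset.erase_subset _ _).trans hKX)) hTc (by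
      have := Finset.card_union_le {u} (K.erase v1)
      rw [Finset.card_erase_of_mem hv1] at this
      simp only [Finset.card_singleton] at this
      omega)
  have hPc : Conn A {u, v1} := by
    have := (conn_singleton A v1).insert (t := u) (by simp) (huA v1 hv1)
    simpa using this
  obtain ⟨w, hw, hwT, hwB⟩ := hA {u, v1} (by
    intro a ha; simp at ha; rcases ha with rfl | rfl
    · exact hu
    · exact hKX hv1) hPc (by
      have := Finset.card_le_two (a := u) (b := v1)
      omega)
  have hnot : ∀ a, B.Adj u a → a ∉ K := by
    intro a ha haK
    exact (hAB a (hKX haK) u hu ha.ne.symm).1 (huA a haK) ha.symm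
  have huz : B.Adj u z := hzB u (by simp)
  have huw : B.Adj u w := hwB u (by simp)
  have hMc : Conn B (insert w (insert z {u})) :=
    ((conn_singleton B u).insert (t := z) (by simp) huz).insert (s := u) (by simp) huw
  have hdis : ∀ k ∈ K, k ∉ insert w (insert z ({u} : Finset V)) := by
    intro k hk h
    simp at h
    rcases h with rfl | rfl | rfl
    · exact hnot _ huw hk
    · exact hnot _ huz hk
    · exact huK hk
  have hadj : ∀ k ∈ K, ∃ a ∈ insert w (insert z ({u} : Finset V)), B.Adj k a := by
    intro k hk
    by_cases h : k = v1
    · subst h; exact ⟨w, by simp, hwB k (by simp)⟩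
    · exact ⟨z, by simp, hzB k (by simp [h, hk])⟩
  have hm : Model B X (fun o : Option K => o.elim (insert w (insert z ({u} : Finset V))) (fun k => {k.1})) := by
    refine ⟨?_, ?_, ?_, ?_⟩
    · rintro (_ | p)
      · intro a ha; simp at ha; rcases ha with rfl | rfl | rfl <;> assumption
      · simpa using hKX p.2
    · rintro (_ | p)
      · exact hMc
      · exact conn_singleton _ _
    · rintro (_ | p) (_ | q) hpq
      · exact absurd rfl hpq
      · simpa using hdis q.1 q.2
      · simpa using hdis p.1 p.2
      · simp at hpq ⊢
        exact fun h => hpq h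
    · rintro (_ | p) (_ | q) hpq
      · exact absurd rfl hpq
      · obtain ⟨a, ha, h⟩ := hadj q.1 q.2
        exact ⟨a, ha, q.1, by simp, h.symm⟩
      · obtain ⟨a, ha, h⟩ := hadj p.1 p.2
        exact ⟨p.1, by simp, a, ha, h⟩
      · exact ⟨p.1, by simp, q.1, by simp, hKq _ p.2 _ q.2 fun h => hpq (by rw [Subtype.ext h])⟩
  have := hm.le_eta
  simp at this
  omega

lemma conn_or {A B : SimpleGraph V} {X : Finset V}
    (hAB : ∀ u ∈ X, ∀ v ∈ X, u ≠ v → (A.Adj u v ↔ ¬ B.Adj u v)) (hX : X.Nonempty) :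
    Conn A X ∨ Conn B X := by
  by_contra h
  push Not at h
  obtain ⟨h1, h2⟩ := h
  apply h1
  apply conn_of_cross hX
  intro P a ha hPa b hb hPb
  by_contra hno
  push Not at hno
  apply h2
  have key : ∀ u ∈ X, ∀ v ∈ X, P u → ¬ P v → B.Adj u v := by
    intro u hu v hv hPu hPv
    by_contra hB
    exact hno u hu v hv hPu hPv ((hAB u hu v hv (by rintro rfl; exact hPv hPu)).2 hB)
  apply conn_of_cross hX
  intro Q x hx hQx y hy hQy
  by_cases hPx : P x <;> by_cases hPy : P y
  · by_cases hQb : Q b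
    · exact ⟨b, hb, y, hy, hQb, hQy, (key y hy b hb hPy hPb).symm⟩
    · exact ⟨x, hx, b, hb, hQx, hQb, (key x hx b hb hPx hPb)⟩
  · exact ⟨x, hx, y, hy, hQx, hQy, (key x hx y hy hPx hPy)⟩
  · exact ⟨x, hx, y, hy, hQx, hQy, (key y hy x hx hPy hPx).symm⟩
  · by_cases hQa : Q a
    · exact ⟨a, ha, y, hy, hQa, hQy, (key a ha y hy hPa hPy)⟩
    · exact ⟨x, hx, a, ha, hQx, hQa, (key a ha x hx hPa hPx).symm⟩

def DomIn (A : SimpleGraph V) (X D : Finset V) : Prop :=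
  D ⊆ X ∧ Conn A D ∧ ∀ y ∈ X, y ∉ D → ∃ d ∈ D, A.Adj d y

lemma two_step {A B : SimpleGraph V} {X D : Finset V}
    (hAB : ∀ u ∈ X, ∀ v ∈ X, u ≠ v → (A.Adj u v ↔ ¬ B.Adj u v)) (hX : X.Nonempty)
    (hD : DomIn A X D) (hmA : ∀ S, DomIn A X S → D.card ≤ S.card)
    (hmB : ∀ S, DomIn B X S → D.card ≤ S.card)
    (ih : (X \ D).card ≤ eta A (X \ D) * eta B (X \ D)) :
    X.card ≤ eta A X * eta B X := by
  have h1 := (good_of_dom hD.1 hD.2.1 hD.2.2).eta hX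
  have h2 : D.card ≤ eta B X := by
    apply two_core hAB hX
    · intro S hS hc hlt
      by_contra hno
      push Not at hno
      have := hmA S ⟨hS, hc, fun y hy hyS => by
        obtain ⟨s, hs, hsy⟩ := hno y hy hyS
        exact ⟨s, hs, (hAB s (hS hs) y hy (by rintro rfl; exact hyS hs)).2 hsy⟩⟩
      omega
    · intro S hS hc hlt
      by_contra hno
      push Not at hno
      have := hmB S ⟨hS, hc, fun y hy hyS => by
        obtain ⟨s, hs, hsy⟩ := hno y hy hyS
        refine ⟨s, hs, ?_⟩
        by_contra hB
        exact hsy ((hAB s (hS hs) y hy (by rintro rfl; exact hyS hs)).2 hB)⟩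
      omega
  have h3 : eta B (X \ D) ≤ eta B X := eta_mono_set B Finset.sdiff_subset
  have h4 : (X \ D).card + D.card = X.card := Finset.card_sdiff_add_card_eq_card hD.1
  calc X.card ≤ eta A (X \ D) * eta B X + eta B X := by
        have := Nat.mul_le_mul_left (eta A (X \ D)) h3
        omega
    _ = (1 + eta A (X \ D)) * eta B X := by ring
    _ ≤ _ := Nat.mul_le_mul_right _ h1

theorem two_thm (A B : SimpleGraph V) : ∀ (k : ℕ) (X : Finset V), X.card = k →
    (∀ u ∈ X, ∀ v ∈ X, u ≠ v → (A.Adj u v ↔ ¬ B.Adj u v)) →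
    X.card ≤ eta A X * eta B X := by
  intro k
  induction k using Nat.strong_induction_on with
  | _ k ih =>
  intro X hk hAB
  rcases X.eq_empty_or_nonempty with rfl | hX
  · simp
  have hBA : ∀ u ∈ X, ∀ v ∈ X, u ≠ v → (B.Adj u v ↔ ¬ A.Adj u v) := by
    intro u hu v hv h
    have := hAB u hu v hv h
    tauto
  let F := X.powerset.filter (fun D => DomIn A X D ∨ DomIn B X D)
  have hF : F.Nonempty := by
    refine ⟨X, ?_⟩
    simp only [F, Finset.mem_filter, Finset.mem_powerset, subset_rfl, true_and]
    rcases conn_or hAB hX with h | h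
    · exact Or.inl ⟨subset_rfl, h, fun y hy hy' => absurd hy hy'⟩
    · exact Or.inr ⟨subset_rfl, h, fun y hy hy' => absurd hy hy'⟩
  obtain ⟨D, hD, hmin⟩ := F.exists_min_image Finset.card hF
  have hmin' : ∀ S, DomIn A X S ∨ DomIn B X S → D.card ≤ S.card := by
    intro S hS
    apply hmin
    simp only [F, Finset.mem_filter, Finset.mem_powerset]
    exact ⟨by rcases hS with h | h <;> exact h.1, hS⟩
  have hD' := (Finset.mem_filter.1 hD).2
  have hDX : D ⊆ X := by rcases hD' with h | h <;> exact h.1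
  have hDn : D.Nonempty := by rcases hD' with h | h <;> exact h.2.1.nonempty
  have hlt : (X \ D).card < k := by
    have : (X \ D).card + D.card = X.card := Finset.card_sdiff_add_card_eq_card hDX
    have := hDn.card_pos
    omega
  have ih' := ih _ hlt (X \ D) rfl (fun u hu v hv => hAB u (Finset.mem_sdiff.1 hu).1 v (Finset.mem_sdiff.1 hv).1)
  rcases hD' with h | h
  · exact two_step hAB hX h (fun S hS => hmin' S (Or.inl hS)) (fun S hS => hmin' S (Or.inr hS)) ih'
  · rw [mul_comm]
    exact two_step hBA hX h (fun S hS => hmin' S (Or.inr hS)) (fun S hS => hmin' S (Or.inl hS))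
      (by rw [mul_comm]; exact ih')

theorem two_cover (A B : SimpleGraph V) (X : Finset V)
    (h : ∀ u ∈ X, ∀ v ∈ X, u ≠ v → A.Adj u v ∨ B.Adj u v) :
    X.card ≤ eta A X * eta B X := by
  refine (two_thm A Aᶜ _ X rfl ?_).trans (Nat.mul_le_mul_left _ ?_)
  · intro u hu v hv huv
    simp [huv]
  · apply eta_mono subset_rfl
    intro u hu v hv huv
    rcases h u hu v hv huv.ne with h | h
    · exact absurd h ((SimpleGraph.compl_adj _ _ _).1 huv).2
    · exact h

end HW


namespace HW
variable {V : Type*} [DecidableEq V]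

def Indep (G : SimpleGraph V) (S : Finset V) : Prop := ∀ u ∈ S, ∀ v ∈ S, ¬ G.Adj u v

structure Inv (G : SimpleGraph V) (X F I D S : Finset V) : Prop where
  sub : D ⊆ X
  conn : Conn G D
  cl : ∀ f ∈ F, f ∈ D → ∀ j ∈ I, j ∉ F → G.Adj f j → j ∈ D
  ssub : S ⊆ D
  disj : Disjoint S I
  ind : Indep G (S ∪ I)
  card : (D \ (I \ F)).card + 2 ≤ 2 * S.card + 3 * (F ∩ D).card

lemma Inv.absorb {G : SimpleGraph V} {X F I D S : Finset V} (h : Inv G X F I D S)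
    (hIX : I ⊆ X) {E : Finset V} (hEX : E ⊆ X) (hc : Conn G (D ∪ E))
    (hE : (E \ (I \ F)).card ≤ 3) {f : V} (hf : f ∈ F) (hfE : f ∈ E) (hfD : f ∉ D) :
    ∃ D', Inv G X F I D' S ∧ D.card < D'.card := by
  let N := (I \ F).filter (fun j => ∃ f ∈ D ∪ E, f ∈ F ∧ G.Adj f j)
  have hN : N ⊆ I \ F := Finset.filter_subset _ _
  refine ⟨(D ∪ E) ∪ N, ⟨?_, ?_, ?_, ?_, h.disj, h.ind, ?_⟩, ?_⟩
  · exact Finset.union_subset (Finset.union_subset h.sub hEX)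
      (hN.trans (Finset.sdiff_subset.trans hIX))
  · apply hc.attach
    intro t ht
    obtain ⟨-, f, h1, h2, h3⟩ := Finset.mem_filter.1 ht
    exact ⟨f, h1, h3⟩
  · intro f hf hfD j hj hjF hfj
    rcases Finset.mem_union.1 hfD with h1 | h1
    · apply Finset.mem_union_right
      exact Finset.mem_filter.2 ⟨Finset.mem_sdiff.2 ⟨hj, hjF⟩, f, h1, hf, hfj⟩
    · exact absurd hf (Finset.mem_sdiff.1 (hN h1)).2
  · exact h.ssub.trans (by intro x hx; simp [hx])
  · have h1 : ((D ∪ E) ∪ N) \ (I \ F) ⊆ (D \ (I \ F)) ∪ (E \ (I \ F)) := by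
      intro x hx
      obtain ⟨hx1, hx2⟩ := Finset.mem_sdiff.1 hx
      rcases Finset.mem_union.1 hx1 with hx1 | hx1
      · rcases Finset.mem_union.1 hx1 with hx1 | hx1
        · exact Finset.mem_union_left _ (Finset.mem_sdiff.2 ⟨hx1, hx2⟩)
        · exact Finset.mem_union_right _ (Finset.mem_sdiff.2 ⟨hx1, hx2⟩)
      · exact absurd (hN hx1) hx2
    have h2 := (Finset.card_le_card h1).trans (Finset.card_union_le _ _)
    have h3 : (insert f (F ∩ D)).card ≤ (F ∩ ((D ∪ E) ∪ N)).card := by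
      apply Finset.card_le_card
      intro x hx
      rcases Finset.mem_insert.1 hx with rfl | hx
      · simp [hf, hfE]
      · simp only [Finset.mem_inter] at hx
        simp [hx.1, hx.2]
    rw [Finset.card_insert_of_notMem (by simp [hfD])] at h3
    have := h.card
    omega
  · apply Finset.card_lt_card
    refine ⟨by intro x hx; simp [hx], fun hsub => hfD (hsub (by simp [hfE]))⟩

lemma lemmaC_conn_aux {G : SimpleGraph V} {X F I : Finset V} (hX : Conn G X) (hF : F ⊆ X)
    (hI : I ⊆ X) (hIF : ∀ i ∈ I, i ∉ F → ∃ f ∈ F, G.Adj f i) :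
    ∀ k D S, X.card - D.card = k → Inv G X F I D S →
    ∃ D' S', Inv G X F I D' S' ∧ F ⊆ D' ∧ (∀ y ∈ X, y ∉ D' → ∃ d ∈ D', G.Adj d y) := by
  intro k
  induction k using Nat.strong_induction_on with
  | _ k ih =>
  intro D S hk hinv
  have cont : ∀ D' S', Inv G X F I D' S' → D.card < D'.card →
      ∃ D' S', Inv G X F I D' S' ∧ F ⊆ D' ∧ (∀ y ∈ X, y ∉ D' → ∃ d ∈ D', G.Adj d y) := by
    intro D' S' h' hlt
    have := Finset.card_le_card h'.sub
    exact ih _ (by omega) D' S' rfl h'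
  by_cases hdom : ∀ y ∈ X, y ∉ D → ∃ d ∈ D, G.Adj d y
  · by_cases hFD : F ⊆ D
    · exact ⟨D, S, hinv, hFD, hdom⟩
    · obtain ⟨f, hf, hfD⟩ := Finset.not_subset.1 hFD
      obtain ⟨d, hd, hdf⟩ := hdom f (hF hf) hfD
      obtain ⟨D', h1, h2⟩ := hinv.absorb hI (E := {f}) (by simpa using hF hf) (hinv.conn.union
        (conn_singleton _ _) hd (by simp) (Or.inl hdf)) ((Finset.card_le_card Finset.sdiff_subset).trans (by simp))
        hf (by simp) hfD
      exact cont D' S h1 h2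
  push Not at hdom
  obtain ⟨y0, hy0, hy0D, hy0n⟩ := hdom
  obtain ⟨d0, hd0⟩ := hinv.conn.nonempty
  obtain ⟨x, hx, y, hy, hPx, hPy, hxy⟩ := hX.cross (fun v => v ∈ D ∨ ∃ d ∈ D, G.Adj d v)
    (hinv.sub hd0) (Or.inl hd0) hy0 (by
      rintro (h | ⟨d, hd, h⟩)
      · exact hy0D h
      · exact hy0n d hd h)
  push Not at hPy
  obtain ⟨hyD, hyn⟩ := hPy
  have hxD : x ∉ D := fun h => hyn x h hxy
  rcases hPx with hPx | ⟨d, hd, hdx⟩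
  · exact absurd hPx hxD
  have c1 : Conn G (insert x D) := hinv.conn.insert hd hdx
  have c2 : Conn G (insert y (insert x D)) := c1.insert (by simp) hxy
  by_cases hxF : x ∈ F
  · obtain ⟨D', h1, h2⟩ := hinv.absorb hI (E := {x}) (by simpa using hx) (by
      have : D ∪ {x} = insert x D := by ext z; simp
      rw [this]; exact c1) ((Finset.card_le_card Finset.sdiff_subset).trans (by simp)) hxF (by simp) hxD
    exact cont D' S h1 h2
  by_cases hyf : ∃ f ∈ F, y = f ∨ G.Adj y f
  · obtain ⟨f, hf, hyf⟩ := hyf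
    have hfD : f ∉ D := by
      intro h
      rcases hyf with rfl | hyf
      · exact hyD h
      · exact hyn f h hyf.symm
    obtain ⟨D', h1, h2⟩ := hinv.absorb hI (E := {f, y, x}) (by
      intro z hz; simp at hz; rcases hz with rfl | rfl | rfl
      · exact hF hf
      · exact hy
      · exact hx) (by
      have : D ∪ {f, y, x} = insert f (insert y (insert x D)) := by ext z; simp
      rw [this]
      rcases hyf with rfl | hyf
      · simpa using c2
      · exact c2.insert (by simp) hyf) ((Finset.card_le_card Finset.sdiff_subset).trans Finset.card_le_three)
      hf (by simp) hfD
    exact cont D' S h1 h2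
  push Not at hyf
  by_cases hyi : ∃ i ∈ I, G.Adj y i
  · obtain ⟨i, hi, hyi⟩ := hyi
    have hiF : i ∉ F := fun h => (hyf i h).2 hyi
    obtain ⟨f, hf, hfi⟩ := hIF i hi hiF
    have hiD : i ∉ D := fun h => hyn i h hyi.symm
    have hfD : f ∉ D := fun h => hiD (hinv.cl f hf h i hi hiF hfi)
    obtain ⟨D', h1, h2⟩ := hinv.absorb hI (E := {f, i, y, x}) (by
      intro z hz; simp at hz; rcases hz with rfl | rfl | rfl | rfl
      · exact hF hf
      · exact hI hi
      · exact hy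
      · exact hx) (by
      have : D ∪ {f, i, y, x} = insert f (insert i (insert y (insert x D))) := by ext z; simp
      rw [this]
      exact (c2.insert (by simp) hyi).insert (by simp) hfi.symm) (by
        refine (Finset.card_le_card (t := {f, y, x}) ?_).trans Finset.card_le_three
        intro z hz
        simp only [Finset.mem_sdiff, Finset.mem_insert, Finset.mem_singleton] at hz ⊢
        rcases hz with ⟨rfl | rfl | rfl | rfl, h⟩
        · simp
        · exact absurd ⟨hi, hiF⟩ h
        · simp
        · simp)
      hf (by simp) hfD
    exact cont D' S h1 h2
  push Not at hyi
  have hyI : y ∉ I := by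
    intro h
    obtain ⟨f, hf, hfi⟩ := hIF y h (fun h => (hyf y h).1 rfl)
    exact (hyf f hf).2 hfi.symm
  have hyF : y ∉ F := fun h => (hyf y h).1 rfl
  have hyS : y ∉ S := fun h => hyD (hinv.ssub h)
  refine cont (insert y (insert x D)) (insert y S) ⟨?_, c2, ?_, ?_, ?_, ?_, ?_⟩ ?_
  · exact Finset.insert_subset hy (Finset.insert_subset hx hinv.sub)
  · intro f hf hfD j hj hjF hfj
    have hfD' : f ∈ D := by
      simp only [Finset.mem_insert] at hfD
      rcases hfD with rfl | rfl | h
      · exact absurd hf hyF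
      · exact absurd hf hxF
      · exact h
    simp [hinv.cl f hf hfD' j hj hjF hfj]
  · exact Finset.insert_subset_insert _ (hinv.ssub.trans (Finset.subset_insert _ _))
  · rw [Finset.disjoint_insert_left]; exact ⟨hyI, hinv.disj⟩
  · have hy' : ∀ v ∈ S ∪ I, ¬ G.Adj y v := by
      intro v hv
      rcases Finset.mem_union.1 hv with hv | hv
      · exact fun h => hyn v (hinv.ssub hv) h.symm
      · exact hyi v hv
    rw [Finset.insert_union]
    intro u hu v hv
    rcases Finset.mem_insert.1 hu with hu | hu <;> rcases Finset.mem_insert.1 hv with hv | hv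
    · rw [hu, hv]; exact G.irrefl
    · rw [hu]; exact hy' v hv
    · rw [hv]; exact fun h => hy' u hu h.symm
    · exact hinv.ind u hu v hv
  · rw [Finset.card_insert_of_notMem hyS]
    have h1 : (insert y (insert x D)) \ (I \ F) ⊆ insert y (insert x (D \ (I \ F))) := by
      intro z hz
      simp only [Finset.mem_sdiff, Finset.mem_insert] at hz ⊢
      tauto
    have h2 := Finset.card_le_card h1
    have h3 := Finset.card_insert_le y (insert x (D \ (I \ F)))
    have h4 := Finset.card_insert_le x (D \ (I \ F))
    have h5 : (F ∩ D).card ≤ (F ∩ insert y (insert x D)).card := by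
      apply Finset.card_le_card
      intro z hz
      simp only [Finset.mem_inter, Finset.mem_insert] at hz ⊢
      tauto
    have := hinv.card
    omega
  · rw [Finset.card_insert_of_notMem (by
      simp only [Finset.mem_insert, not_or]; exact ⟨hxy.ne.symm, hyD⟩), Finset.card_insert_of_notMem hxD]
    omega

lemma lemmaC_conn {G : SimpleGraph V} {X F I : Finset V} (hX : Conn G X) (hF : F ⊆ X)
    (hF0 : F.Nonempty) (hI : I ⊆ X) (hind : Indep G I)
    (hIF : ∀ i ∈ I, i ∉ F → ∃ f ∈ F, G.Adj f i) :
    ∃ D S, Good G X D ∧ S ⊆ X ∧ Indep G S ∧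
      D.card + 2 * I.card + 2 ≤ (I \ F).card + 3 * F.card + 2 * S.card := by
  obtain ⟨f0, hf0⟩ := hF0
  have hstart : Inv G X F I ({f0} ∪ (I \ F).filter (fun j => G.Adj f0 j)) ∅ := by
    refine ⟨?_, ?_, ?_, ?_, ?_, ?_, ?_⟩
    · apply Finset.union_subset (by simpa using hF hf0)
      exact (Finset.filter_subset _ _).trans (Finset.sdiff_subset.trans hI)
    · apply (conn_singleton G f0).attach
      intro t ht
      exact ⟨f0, by simp, (Finset.mem_filter.1 ht).2⟩
    · intro f hf hfD j hj hjF hfj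
      have : f = f0 := by
        rcases Finset.mem_union.1 hfD with h | h
        · simpa using h
        · simp at h; exact absurd hf h.1.2
      subst this
      simp [hj, hjF, hfj]
    · simp
    · simp
    · simpa using hind
    · have h1 : ({f0} ∪ (I \ F).filter (fun j => G.Adj f0 j)) \ (I \ F) ⊆ {f0} := by
        intro z hz
        simp only [Finset.mem_sdiff, Finset.mem_union, Finset.mem_filter] at hz
        tauto
      have h2 := Finset.card_le_card h1
      have h3 : 0 < (F ∩ ({f0} ∪ (I \ F).filter (fun j => G.Adj f0 j))).card :=
        Finset.card_pos.2 ⟨f0, by simp [hf0]⟩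
      simp only [Finset.card_singleton, Finset.card_empty] at h2 ⊢
      omega
  obtain ⟨D, S, hinv, hFD, hdom⟩ := lemmaC_conn_aux hX hF hI hIF _ _ _ rfl hstart
  refine ⟨D, S ∪ I, good_of_dom hinv.sub hinv.conn hdom,
    Finset.union_subset (hinv.ssub.trans hinv.sub) hI, hinv.ind, ?_⟩
  rw [Finset.card_union_of_disjoint hinv.disj]
  have h1 : D ⊆ (D \ (I \ F)) ∪ (I \ F) := by
    intro z hz
    by_cases h : z ∈ I \ F
    · exact Finset.mem_union_right _ h
    · exact Finset.mem_union_left _ (Finset.mem_sdiff.2 ⟨hz, h⟩)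
  have h2 := (Finset.card_le_card h1).trans (Finset.card_union_le _ _)
  have h3 := hinv.card
  rw [Finset.inter_eq_left.2 hFD] at h3
  omega

lemma good_union {G : SimpleGraph V} {X1 X2 D1 D2 : Finset V}
    (hno : ∀ u ∈ X1, ∀ w ∈ X2, ¬ G.Adj u w) (hdis : Disjoint X1 X2)
    (h1 : Good G X1 D1) (h2 : Good G X2 D2) : Good G (X1 ∪ X2) (D1 ∪ D2) := by
  have hT : ∀ T ⊆ X1 ∪ X2, Conn G T → ∀ x ∈ T, x ∈ X1 → T ⊆ X1 := by
    intro T hT hc x hx hx1 y hy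
    by_contra hy1
    obtain ⟨u, hu, v, hv, h1, h2, huv⟩ := hc.cross (fun z => z ∈ X1) hx hx1 hy hy1
    exact hno u h1 v ((Finset.mem_union.1 (hT hv)).resolve_left h2) huv
  have hT2 : ∀ T ⊆ X1 ∪ X2, Conn G T → ∀ x ∈ T, x ∈ X2 → T ⊆ X2 := by
    intro T hT hc x hx hx1 y hy
    by_contra hy1
    obtain ⟨u, hu, v, hv, h1, h2, huv⟩ := hc.cross (fun z => z ∈ X2) hx hx1 hy hy1
    exact hno v ((Finset.mem_union.1 (hT hv)).resolve_right h2) u h1 huv.symm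
  refine ⟨Finset.union_subset_union h1.1 h2.1, fun x hx => ?_⟩
  rcases Finset.mem_union.1 hx with hx | hx
  · obtain ⟨D', hD', hc, h⟩ := h1.2 x hx
    refine ⟨D', hD'.trans Finset.subset_union_left, hc, fun T hTX hTc hxT y hy hyD => ?_⟩
    exact h T (hT T hTX hTc x hxT hx) hTc hxT y hy (fun h => hyD (Finset.mem_union_left _ h))
  · obtain ⟨D', hD', hc, h⟩ := h2.2 x hx
    refine ⟨D', hD'.trans Finset.subset_union_right, hc, fun T hTX hTc hxT y hy hyD => ?_⟩
    exact h T (hT2 T hTX hTc x hxT hx) hTc hxT y hy (fun h => hyD (Finset.mem_union_right _ h))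

lemma lemmaC_gen (G : SimpleGraph V) : ∀ (k : ℕ) (X F I : Finset V), X.card = k → F ⊆ X →
    I ⊆ X → Indep G I → (∀ i ∈ I, i ∉ F → ∃ f ∈ F, G.Adj f i) →
    ∃ D S, Good G X D ∧ S ⊆ X ∧ Indep G S ∧
      D.card + 2 * I.card + (if F.Nonempty then 2 else 0) ≤
        (I \ F).card + 3 * F.card + 2 * S.card := by
  intro k
  induction k using Nat.strong_induction_on with
  | _ k ih =>
  intro X F I hk hF hI hind hIF
  rcases X.eq_empty_or_nonempty with rfl | hX
  · have hF0 : F = ∅ := Finset.subset_empty.1 hF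
    have hI0 : I = ∅ := Finset.subset_empty.1 hI
    subst hF0; subst hI0
    exact ⟨∅, ∅, ⟨subset_rfl, fun x hx => absurd hx (by simp)⟩, subset_rfl, hind, by simp⟩
  obtain ⟨v, hv, hvF⟩ : ∃ v ∈ X, (F.Nonempty → v ∈ F) := by
    by_cases h : F.Nonempty
    · obtain ⟨v, hv⟩ := h; exact ⟨v, hF hv, fun _ => hv⟩
    · obtain ⟨v, hv⟩ := hX; exact ⟨v, hv, fun h' => absurd h' h⟩
  obtain ⟨Y, hYX, hvY, hYc, hYn⟩ := exists_comp G hv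
  have hlt : (X \ Y).card < k := by
    have : (X \ Y).card + Y.card = X.card := Finset.card_sdiff_add_card_eq_card hYX
    have := hYc.nonempty.card_pos
    omega
  obtain ⟨D2, S2, hg2, hS2, hi2, hc2⟩ := ih _ hlt (X \ Y) (F \ Y) (I \ Y) rfl
    (Finset.sdiff_subset_sdiff hF subset_rfl) (Finset.sdiff_subset_sdiff hI subset_rfl)
    (fun u hu v hv => hind u (Finset.mem_sdiff.1 hu).1 v (Finset.mem_sdiff.1 hv).1) (by
      intro i hi hiF
      obtain ⟨hi, hiY⟩ := Finset.mem_sdiff.1 hi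
      obtain ⟨f, hf, hfi⟩ := hIF i hi (fun h => hiF (Finset.mem_sdiff.2 ⟨h, hiY⟩))
      refine ⟨f, Finset.mem_sdiff.2 ⟨hf, fun hfY => hYn f hfY i (hI hi) hiY hfi⟩, hfi⟩)
  have hno : ∀ u ∈ Y, ∀ w ∈ X \ Y, ¬ G.Adj u w := fun u hu w hw =>
    hYn u hu w (Finset.mem_sdiff.1 hw).1 (Finset.mem_sdiff.1 hw).2
  have hun : Y ∪ (X \ Y) = X := Finset.union_sdiff_of_subset hYX
  have fin : ∀ D1 S1, Good G Y D1 → S1 ⊆ Y → Indep G S1 →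
      Good G X (D1 ∪ D2) ∧ S1 ∪ S2 ⊆ X ∧ Indep G (S1 ∪ S2) ∧ (D1 ∪ D2).card ≤ D1.card + D2.card ∧
      (S1 ∪ S2).card = S1.card + S2.card := by
    intro D1 S1 hg1 hS1 hi1
    refine ⟨?_, ?_, ?_, Finset.card_union_le _ _, ?_⟩
    · have := good_union hno Finset.disjoint_sdiff hg1 hg2
      rwa [hun] at this
    · exact Finset.union_subset (hS1.trans hYX) (hS2.trans Finset.sdiff_subset)
    · intro u hu v hv
      rcases Finset.mem_union.1 hu with hu | hu <;> rcases Finset.mem_union.1 hv with hv | hv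
      · exact hi1 u hu v hv
      · exact hno u (hS1 hu) v (hS2 hv)
      · exact fun h => hno v (hS1 hv) u (hS2 hu) h.symm
      · exact hi2 u hu v hv
    · apply Finset.card_union_of_disjoint
      exact Finset.disjoint_of_subset_left hS1 (Finset.disjoint_of_subset_right hS2 Finset.disjoint_sdiff)
  by_cases hFn : F.Nonempty
  · obtain ⟨D1, S1, hg1, hS1, hi1, hc1⟩ := lemmaC_conn (F := F ∩ Y) (I := I ∩ Y) hYc
      Finset.inter_subset_right ⟨v, by simp [hvF hFn, hvY]⟩ Finset.inter_subset_right
      (fun u hu v hv => hind u (Finset.mem_inter.1 hu).1 v (Finset.mem_inter.1 hv).1) (by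
        intro i hi hiF
        obtain ⟨hi, hiY⟩ := Finset.mem_inter.1 hi
        obtain ⟨f, hf, hfi⟩ := hIF i hi (fun h => hiF (Finset.mem_inter.2 ⟨h, hiY⟩))
        refine ⟨f, Finset.mem_inter.2 ⟨hf, ?_⟩, hfi⟩
        by_contra hfY
        exact hYn i hiY f (hF hf) hfY hfi.symm)
    obtain ⟨a1, a2, a3, a4, a5⟩ := fin D1 S1 hg1 hS1 hi1
    refine ⟨D1 ∪ D2, S1 ∪ S2, a1, a2, a3, ?_⟩
    rw [if_pos hFn]
    have b1 := Finset.card_sdiff_add_card_inter I Y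
    have b2 := Finset.card_sdiff_add_card_inter F Y
    have b3 := Finset.card_sdiff_add_card_inter (I \ F) Y
    have b4 : (I \ F) \ Y = (I \ Y) \ (F \ Y) := by ext z; simp; tauto
    have b5 : (I \ F) ∩ Y = (I ∩ Y) \ (F ∩ Y) := by ext z; simp; tauto
    rw [b4, b5] at b3
    omega
  · have hF0 : F = ∅ := Finset.not_nonempty_iff_eq_empty.1 hFn
    subst hF0
    have hI0 : I = ∅ := by
      by_contra h
      obtain ⟨i, hi⟩ := Finset.nonempty_iff_ne_empty.2 h
      obtain ⟨f, hf, -⟩ := hIF i hi (by simp)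
      simp at hf
    subst hI0
    obtain ⟨D1, S1, hg1, hS1, hi1, hc1⟩ := lemmaC_conn (F := {v}) (I := {v}) hYc
      (by simpa using hvY) (by simp) (by simpa using hvY) (by
        intro u hu v hv; simp at hu hv; rw [hu, hv]; exact G.irrefl) (by
        intro i hi hi'; exact absurd hi hi')
    obtain ⟨a1, a2, a3, a4, a5⟩ := fin D1 S1 hg1 hS1 hi1
    refine ⟨D1 ∪ D2, S1 ∪ S2, a1, a2, a3, ?_⟩
    simp at hc1 hc2 ⊢
    omega

lemma lemmaC (G : SimpleGraph V) {X F I : Finset V} (hF : F ⊆ X) (hF0 : F.Nonempty)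
    (hI : I ⊆ X) (hind : Indep G I) (hIF : ∀ i ∈ I, i ∉ F → ∃ f ∈ F, G.Adj f i) :
    ∃ D S, Good G X D ∧ S ⊆ X ∧ Indep G S ∧
      D.card + 2 * I.card + 2 ≤ (I \ F).card + 3 * F.card + 2 * S.card := by
  obtain ⟨D, S, h1, h2, h3, h4⟩ := lemmaC_gen G _ X F I rfl hF hI hind hIF
  rw [if_pos hF0] at h4
  exact ⟨D, S, h1, h2, h3, h4⟩

lemma lemmaC_one (G : SimpleGraph V) {X : Finset V} (hX : X.Nonempty) :
    ∃ D S, Good G X D ∧ S ⊆ X ∧ Indep G S ∧ D.card + 1 ≤ 2 * S.card ∧ D.Nonempty := by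
  obtain ⟨v, hv⟩ := hX
  obtain ⟨D, S, h1, h2, h3, h4⟩ := lemmaC G (X := X) (F := {v}) (I := {v}) (by simpa using hv) (by simp)
    (by simpa using hv) (by
        intro u hu v hv; simp at hu hv; rw [hu, hv]; exact G.irrefl) (by
        intro i hi hi'; exact absurd hi hi')
  simp at h4
  refine ⟨D, S, h1, h2, h3, by omega, ?_⟩
  obtain ⟨D', hD', hc, -⟩ := h1.2 v hv
  exact hc.nonempty.mono hD'

/-- Duchet-Meyniel -/
lemma dm (G : SimpleGraph V) (X : Finset V) (hX : X.Nonempty) : ∃ I ⊆ X, Indep G I ∧ 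
    X.card + eta G X ≤ 2 * I.card * eta G X := by
  let F := X.powerset.filter (fun I => Indep G I)
  have hF : F.Nonempty := ⟨∅, Finset.mem_filter.2 ⟨by simp, fun u hu => absurd hu (by simp)⟩⟩
  obtain ⟨I, hI, hmax⟩ := F.exists_max_image Finset.card hF
  have hI' : I ⊆ X ∧ Indep G I := by simpa [F] using hI
  have hm : ∀ S ⊆ X, Indep G S → S.card ≤ I.card := fun S h1 h2 => hmax S (by simp [F, h1, h2])
  refine ⟨I, hI'.1, hI'.2, ?_⟩
  have key : ∀ k, ∀ Y ⊆ X, Y.card = k → Y.card + eta G Y ≤ 2 * I.card * eta G Y := by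
    intro k
    induction k using Nat.strong_induction_on with
    | _ k ih =>
    intro Y hY hk
    rcases Y.eq_empty_or_nonempty with rfl | hY0
    · have := eta_le_card G (∅ : Finset V)
      simp at this
      simp [this]
    obtain ⟨D, S, hg, hS, hSi, hc, hD0⟩ := lemmaC_one G hY0
    have h1 := hm S (hS.trans hY) hSi
    have h2 := hg.eta hY0
    have h4 : (Y \ D).card + D.card = Y.card := Finset.card_sdiff_add_card_eq_card hg.1
    have h5 := hD0.card_pos
    have h3 := ih _ (by omega) (Y \ D) (Finset.sdiff_subset.trans hY) rfl
    obtain ⟨m, hm⟩ : ∃ m, eta G Y = 1 + eta G (Y \ D) + m := ⟨_, (Nat.add_sub_cancel' h2).symm⟩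
    rw [hm]
    have h6 : m ≤ 2 * I.card * m := Nat.le_mul_of_pos_left _ (by omega)
    nlinarith
  exact key _ X subset_rfl rfl

end HW


namespace HW
variable {V : Type*} [DecidableEq V] {ι : Type*} [DecidableEq ι]

def Cov (G : ι → SimpleGraph V) (C : Finset ι) (X : Finset V) : Prop :=
  ∀ u ∈ X, ∀ v ∈ X, u ≠ v → ∃ i ∈ C, (G i).Adj u v

noncomputable def PP (G : ι → SimpleGraph V) (C : Finset ι) (X : Finset V) : ℝ :=
  ∏ i ∈ C, (eta (G i) X : ℝ)

structure Ctx (G : ι → SimpleGraph V) (C : Finset ι) (X : Finset V) (B : ℝ) : Prop where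
  hB : 0 < B
  ihr : ∀ (G' : ι → SimpleGraph V), ∀ i ∈ C, ∀ Z : Finset V, Cov G' (C.erase i) Z →
    B * Z.card ≤ PP G' (C.erase i) Z
  ihn : ∀ Y : Finset V, Y ⊂ X → 0.513 * B * Y.card ≤ PP G C Y
  cov : Cov G C X
  lt : PP G C X < 0.513 * B * X.card

lemma PP_nonneg (G : ι → SimpleGraph V) (C : Finset ι) (X : Finset V) : 0 ≤ PP G C X :=
  Finset.prod_nonneg fun _ _ => Nat.cast_nonneg _

lemma PP_mono {G H : ι → SimpleGraph V} {C : Finset ι} {X Y : Finset V}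
    (h : ∀ i ∈ C, eta (G i) X ≤ eta (H i) Y) : PP G C X ≤ PP H C Y :=
  Finset.prod_le_prod (fun _ _ => Nat.cast_nonneg _) (fun i hi => by exact_mod_cast h i hi)

lemma PP_erase (G : ι → SimpleGraph V) {C : Finset ι} {i : ι} (hi : i ∈ C) (X : Finset V) :
    PP G C X = eta (G i) X * PP G (C.erase i) X := by
  unfold PP
  rw [Finset.mul_prod_erase C (fun i => (eta (G i) X : ℝ)) hi]

namespace Ctx
variable {G : ι → SimpleGraph V} {C : Finset ι} {X : Finset V} {B : ℝ}

lemma card_pos (h : Ctx G C X B) : (0 : ℝ) < X.card := by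
  have h1 := (PP_nonneg G C X).trans_lt h.lt
  have h2 := h.hB
  by_contra h3
  push Not at h3
  have : 0.513 * B * X.card ≤ 0 := mul_nonpos_of_nonneg_of_nonpos (by positivity) h3
  linarith

lemma nonempty (h : Ctx G C X B) : X.Nonempty := by
  have := h.card_pos
  rw [← Finset.card_pos]
  exact_mod_cast this

lemma eta_pos (h : Ctx G C X B) (i : ι) : (1 : ℝ) ≤ eta (G i) X := by
  exact_mod_cast one_le_eta (G i) h.nonempty

lemma Q_ge (h : Ctx G C X B) {i : ι} (hi : i ∈ C) {S : Finset V} (hS : S ⊆ X)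
    (hind : Indep (G i) S) : B * S.card ≤ PP G (C.erase i) X := by
  refine (h.ihr G i hi S ?_).trans (PP_mono fun j _ => eta_mono_set _ hS)
  intro u hu v hv huv
  obtain ⟨j, hj, hjuv⟩ := h.cov u (hS hu) v (hS hv) huv
  refine ⟨j, Finset.mem_erase.2 ⟨?_, hj⟩, hjuv⟩
  rintro rfl
  exact hind u hu v hv hjuv

lemma e1 (h : Ctx G C X B) {i : ι} (hi : i ∈ C) {S : Finset V} (hS : S ⊆ X)
    (hind : Indep (G i) S) : (eta (G i) X : ℝ) * S.card < 0.513 * X.card := by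
  have h1 := h.Q_ge hi hS hind
  have h2 := h.lt
  rw [PP_erase G hi] at h2
  have h3 : (eta (G i) X : ℝ) * (B * S.card) ≤ eta (G i) X * PP G (C.erase i) X :=
    mul_le_mul_of_nonneg_left h1 (Nat.cast_nonneg _)
  have h4 : B * ((eta (G i) X : ℝ) * S.card) < B * (0.513 * X.card) := by linarith
  exact lt_of_mul_lt_mul_left h4 h.hB.le

lemma e2 (h : Ctx G C X B) {i : ι} (hi : i ∈ C) {S D : Finset V} (hS : S ⊆ X)
    (hind : Indep (G i) S) (hD : Good (G i) X D) : (S.card : ℝ) < 0.513 * D.card := by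
  have h1 := h.Q_ge hi hS hind
  have h2 := h.lt
  have hDn : D.Nonempty := by
    obtain ⟨x, hx⟩ := h.nonempty
    obtain ⟨D', hD', hc, -⟩ := hD.2 x hx
    exact hc.nonempty.mono hD'
  have h3 : 1 + (eta (G i) (X \ D) : ℝ) ≤ eta (G i) X := by exact_mod_cast hD.eta h.nonempty
  have h4 := h.ihn (X \ D) (Finset.sdiff_ssubset hD.1 hDn)
  have h5 : ((X \ D).card : ℝ) + D.card = X.card := by
    exact_mod_cast Finset.card_sdiff_add_card_eq_card hD.1
  have h6 : PP G (C.erase i) (X \ D) ≤ PP G (C.erase i) X :=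
    PP_mono fun j _ => eta_mono_set _ Finset.sdiff_subset
  rw [PP_erase G hi] at h2 h4
  have h7 := PP_nonneg G (C.erase i) X
  have h8 : (1 + (eta (G i) (X \ D) : ℝ)) * PP G (C.erase i) X ≤ eta (G i) X * PP G (C.erase i) X :=
    mul_le_mul_of_nonneg_right h3 h7
  have h9 : (eta (G i) (X \ D) : ℝ) * PP G (C.erase i) (X \ D) ≤
      eta (G i) (X \ D) * PP G (C.erase i) X :=
    mul_le_mul_of_nonneg_left h6 (Nat.cast_nonneg _)
  have h10 : B * (S.card : ℝ) < B * (0.513 * D.card) := by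
    rw [← h5] at h2
    nlinarith
  exact lt_of_mul_lt_mul_left h10 h.hB.le

lemma hub (h : Ctx G C X B) {i : ι} (hi : i ∈ C) {F I : Finset V} (hF : F ⊆ X) (hF0 : F.Nonempty)
    (hI : I ⊆ X) (hind : Indep (G i) I) (hIF : ∀ j ∈ I, j ∉ F → ∃ f ∈ F, (G i).Adj f j) :
    (eta (G i) X : ℝ) * (2 * I.card + 2 - (I \ F).card - 3 * F.card) < 0.026 * X.card := by
  obtain ⟨D, S, hg, hS, hSi, hc⟩ := lemmaC (G i) hF hF0 hI hind hIF
  have h1 := h.e1 hi hS hSi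
  have h2 := h.e2 hi hS hSi hg
  have h3 : (D.card : ℝ) + 2 * I.card + 2 ≤ (I \ F).card + 3 * F.card + 2 * S.card := by
    exact_mod_cast hc
  have h4 := h.eta_pos i
  have h5 : (2 * I.card + 2 - (I \ F).card - 3 * F.card : ℝ) ≤ S.card * (0.026 / 0.513) := by
    linarith
  calc (eta (G i) X : ℝ) * (2 * I.card + 2 - (I \ F).card - 3 * F.card)
      ≤ eta (G i) X * (S.card * (0.026 / 0.513)) := mul_le_mul_of_nonneg_left h5 (by linarith)
    _ = (eta (G i) X * S.card) * (0.026 / 0.513) := by ring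
    _ < 0.513 * X.card * (0.026 / 0.513) := mul_lt_mul_of_pos_right h1 (by norm_num)
    _ = 0.026 * X.card := by ring

lemma eta_lt (h : Ctx G C X B) {i : ι} (hi : i ∈ C) : (eta (G i) X : ℝ) < 0.026 * X.card := by
  obtain ⟨v, hv⟩ := h.nonempty
  have := h.hub hi (F := {v}) (I := {v}) (by simpa using hv) (by simp) (by simpa using hv) (by
    intro u hu v hv; simp at hu hv; rw [hu, hv]; exact (G i).irrefl) (by
        intro i hi hi'; exact absurd hi hi')
  simp at this
  norm_num at this ⊢
  linarith

lemma dm' (i : ι) {Y : Finset V} (hY : Y ⊆ X) (hY0 : Y.Nonempty) : ∃ I ⊆ Y, Indep (G i) I ∧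
    1 ≤ I.card ∧ (Y.card : ℝ) ≤ (2 * I.card - 1) * eta (G i) X := by
  obtain ⟨I, h1, h2, h3⟩ := dm (G i) Y hY0
  have h4 := eta_mono_set (G i) hY
  have h5 : 1 ≤ I.card := by
    by_contra h
    have : I.card = 0 := by omega
    have := hY0.card_pos
    simp_all
  refine ⟨I, h1, h2, h5, ?_⟩
  have h6 : (Y.card : ℝ) + eta (G i) Y ≤ 2 * I.card * eta (G i) Y := by exact_mod_cast h3
  have h7 : (eta (G i) Y : ℝ) ≤ eta (G i) X := by exact_mod_cast h4
  have h8 : (1 : ℝ) ≤ I.card := by exact_mod_cast h5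
  nlinarith

lemma C_nonempty (h : Ctx G C X B) (hC : C.Nonempty) : (38 : ℝ) < X.card := by
  obtain ⟨i, hi⟩ := hC
  have := h.eta_lt hi
  have := h.eta_pos i
  linarith

lemma big (h : Ctx G C X B) (hC0 : C.Nonempty) : 12 < C.card := by
  by_contra hC
  push Not at hC
  have hn := h.C_nonempty hC0
  obtain ⟨v, hv⟩ := h.nonempty
  have h1 : (X.erase v).card ≤ ∑ i ∈ C, (X.filter (fun u => (G i).Adj v u)).card := by
    refine (Finset.card_le_card ?_).trans Finset.card_biUnion_le
    intro u hu
    obtain ⟨hne, hu⟩ := Finset.mem_erase.1 hu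
    obtain ⟨i, hi, hiu⟩ := h.cov v hv u hu hne.symm
    simp only [Finset.mem_biUnion, Finset.mem_filter]
    exact ⟨i, hi, hu, hiu⟩
  rw [Finset.card_erase_of_mem hv] at h1
  have h2 : ∀ i ∈ C, ((X.filter (fun u => (G i).Adj v u)).card : ℝ) ≤ 0.078 * X.card := by
    intro i hi
    set N := X.filter (fun u => (G i).Adj v u) with hN
    rcases N.eq_empty_or_nonempty with h0 | h0
    · rw [h0]; simp; positivity
    obtain ⟨I, hIN, hind, hI1, hIc⟩ := dm' (G := G) i (X := X) (Finset.filter_subset _ _) h0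
    have hvI : v ∉ I := by
      intro hv'
      have := (Finset.mem_filter.1 (hIN hv')).2
      exact (G i).irrefl this
    have h3 := h.hub hi (F := {v}) (I := I) (by simpa using hv) (by simp)
      (hIN.trans (Finset.filter_subset _ _)) hind (fun j hj _ => ⟨v, by simp, (Finset.mem_filter.1 (hIN hj)).2⟩)
    have h4 : I \ {v} = I := by
      rw [Finset.sdiff_eq_self_iff_disjoint]; simpa using hvI
    rw [h4] at h3
    have h5 := h.eta_lt hi
    simp only [Finset.card_singleton, Nat.cast_one] at h3
    norm_num at *
    nlinarith
  have h3 : ((X.card - 1 : ℕ) : ℝ) ≤ ∑ i ∈ C, ((X.filter (fun u => (G i).Adj v u)).card : ℝ) := by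
    exact_mod_cast h1
  have h4 := h3.trans (Finset.sum_le_sum h2)
  rw [Finset.sum_const, nsmul_eq_mul] at h4
  have h5 : (C.card : ℝ) ≤ 12 := by exact_mod_cast hC
  have h6 : (1 : ℕ) ≤ X.card := Finset.card_pos.2 h.nonempty
  push_cast [h6] at h4
  have h7 : (C.card : ℝ) * (0.078 * X.card) ≤ 12 * (0.078 * X.card) :=
    mul_le_mul_of_nonneg_right h5 (by positivity)
  linarith

end Ctx
end HW


namespace HW
variable {V : Type*} [DecidableEq V] {ι : Type*} [DecidableEq ι]

/-- neighbours in a set -/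
noncomputable def nb (G : SimpleGraph V) (Y : Finset V) (v : V) : Finset V := Y.filter (fun u => G.Adj v u)

lemma mem_nb {G : SimpleGraph V} {Y : Finset V} {v u : V} : u ∈ nb G Y v ↔ u ∈ Y ∧ G.Adj v u := by
  simp [nb]

lemma sum_nb_comm (G : SimpleGraph V) (A Y : Finset V) :
    ∑ u ∈ A, (nb G Y u).card = ∑ v ∈ Y, (nb G A v).card := by
  simp only [nb, Finset.card_filter]
  rw [Finset.sum_comm]
  simp only [G.adj_comm]

noncomputable def Hv (G : SimpleGraph V) (X : Finset V) : Finset V :=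
  X.filter (fun v => 4000 * eta G X ≤ (nb G X v).card)

lemma num13 (k : ℕ) : (8000 : ℝ) * (13 + k) * 0.513 ^ (11 + k) ≤ 0.026 * 2 ^ (12 + k) := by
  induction k with
  | zero => norm_num
  | succ k ih =>
    push_cast
    have h1 : (0.513 : ℝ) ^ (11 + (k + 1)) = 0.513 ^ (11 + k) * 0.513 := by ring
    have h2 : (2 : ℝ) ^ (12 + (k + 1)) = 2 ^ (12 + k) * 2 := by ring
    rw [h1, h2]
    have h3 : (0 : ℝ) ≤ 0.513 ^ (11 + k) := by positivity
    have h4 : (0 : ℝ) ≤ k := Nat.cast_nonneg _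
    have h5 : (0 : ℝ) ≤ 0.513 ^ (11 + k) * k := by positivity
    nlinarith

namespace Ctx
variable {G : ι → SimpleGraph V} {C : Finset ι} {X : Finset V} {B : ℝ}

lemma two_le (h : Ctx G C X B) {i : ι} (hi : i ∈ C) : 2 ≤ eta (G i) X := by
  by_contra hlt
  have hno : Indep (G i) X := by
    intro u hu v hv huv
    exact hlt (two_le_eta hu hv huv)
  have h1 := h.Q_ge hi subset_rfl hno
  have h2 := h.lt
  rw [PP_erase G hi] at h2
  have h3 := h.eta_pos i
  have h4 := PP_nonneg G (C.erase i) X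
  have h5 : 0 < B * X.card := mul_pos h.hB h.card_pos
  nlinarith

lemma eta_pow (h : Ctx G C X B) {i : ι} (hi : i ∈ C) :
    (eta (G i) X : ℝ) * 2 ^ (C.card - 1) < 0.513 * B * X.card := by
  refine lt_of_le_of_lt ?_ h.lt
  rw [PP_erase G hi]
  apply mul_le_mul_of_nonneg_left _ (Nat.cast_nonneg _)
  unfold PP
  rw [← Finset.card_erase_of_mem hi]
  rw [← Finset.prod_const]
  apply Finset.prod_le_prod (fun _ _ => by norm_num)
  intro j hj
  exact_mod_cast h.two_le (Finset.mem_of_mem_erase hj)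

lemma heavy (h : Ctx G C X B) {i : ι} (hi : i ∈ C) :
    ((Hv (G i) X).card : ℝ) ≤ 0.076 * X.card := by
  by_contra hlt
  push Not at hlt
  set H := Hv (G i) X with hH
  have hHX : H ⊆ X := Finset.filter_subset _ _
  have hn := h.card_pos
  have he := h.eta_pos i
  set η : ℝ := (eta (G i) X : ℝ) with hη
  have hHpos : (0 : ℝ) < H.card := by nlinarith
  let g : ℝ := 800 * η * H.card / X.card
  have hg : 0 < g := by positivity
  have hgn : g * X.card = 800 * η * H.card := by
    simp only [g]; field_simp
  let N : Finset V → Finset V := fun F => H.filter (fun v => ∃ f ∈ F, (G i).Adj f v)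
  obtain ⟨F, hF, hmax⟩ := X.powerset.exists_max_image (fun F => ((N F).card : ℝ) - g * F.card)
    ⟨∅, by simp⟩
  simp only [Finset.mem_powerset] at hF hmax
  have h1 : g * F.card ≤ (N F).card := by
    have := hmax ∅ (by simp)
    have h0 : (0 : ℝ) ≤ (N ∅).card := Nat.cast_nonneg _
    simp only [Finset.card_empty, Nat.cast_zero, mul_zero, sub_zero] at this
    linarith
  have h2 : ((N F).card : ℝ) ≤ H.card := by exact_mod_cast Finset.card_filter_le _ _
  have h3 : 800 * (η * F.card) ≤ X.card := by
    have : g * F.card * X.card ≤ H.card * X.card := mul_le_mul_of_nonneg_right (h1.trans h2) hn.le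
    have h4 : H.card * (800 * (η * F.card)) ≤ H.card * (X.card : ℝ) := by
      calc H.card * (800 * (η * F.card)) = g * X.card * F.card := by rw [hgn]; ring
        _ = g * F.card * X.card := by ring
        _ ≤ _ := this
    exact le_of_mul_le_mul_left h4 hHpos
  let U := H \ N F
  have hU : ∀ x ∈ X, ((nb (G i) U x).card : ℝ) ≤ g := by
    intro x hx
    have h4 := hmax (insert x F) (Finset.insert_subset hx hF)
    have h5 : (N F).card + (nb (G i) U x).card ≤ (N (insert x F)).card := by
      rw [← Finset.card_union_of_disjoint]
      · apply Finset.card_le_card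
        intro z hz
        rcases Finset.mem_union.1 hz with hz | hz
        · obtain ⟨hz1, f, hf, hfz⟩ := Finset.mem_filter.1 hz
          exact Finset.mem_filter.2 ⟨hz1, f, by simp [hf], hfz⟩
        · obtain ⟨hz1, hz2⟩ := mem_nb.1 hz
          exact Finset.mem_filter.2 ⟨(Finset.mem_sdiff.1 hz1).1, x, by simp, hz2⟩
      · rw [Finset.disjoint_left]
        intro z hz hz'
        exact (Finset.mem_sdiff.1 (mem_nb.1 hz').1).2 hz
    have h6 : ((N F).card : ℝ) + (nb (G i) U x).card ≤ (N (insert x F)).card := by exact_mod_cast h5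
    have h7 : ((insert x F).card : ℝ) ≤ F.card + 1 := by exact_mod_cast Finset.card_insert_le _ _
    have h8 : g * (insert x F).card ≤ g * (F.card + 1) := mul_le_mul_of_nonneg_left h7 hg.le
    linarith
  have hU2 : (U.card : ℝ) * (4000 * η) ≤ X.card * g := by
    have h4 : (U.card : ℝ) * (4000 * η) ≤ ∑ u ∈ U, ((nb (G i) X u).card : ℝ) := by
      rw [← nsmul_eq_mul]
      apply Finset.card_nsmul_le_sum
      intro u hu
      have := (Finset.mem_filter.1 (Finset.mem_sdiff.1 hu).1).2
      rw [hη]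
      exact_mod_cast this
    have h5 : ∑ u ∈ U, ((nb (G i) X u).card : ℝ) = ∑ v ∈ X, ((nb (G i) U v).card : ℝ) := by
      exact_mod_cast sum_nb_comm (G i) U X
    have h6 := Finset.sum_le_sum hU
    rw [Finset.sum_const, nsmul_eq_mul] at h6
    linarith
  have hU3 : (U.card : ℝ) ≤ 0.2 * H.card := by
    have : (4000 * η) * U.card ≤ (4000 * η) * (0.2 * H.card) := by nlinarith
    exact le_of_mul_le_mul_left this (by positivity)
  have hUN : (U.card : ℝ) + (N F).card = H.card := by
    exact_mod_cast Finset.card_sdiff_add_card_eq_card (Finset.filter_subset _ _)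
  let W := N F \ F
  have hW : ((N F).card : ℝ) ≤ W.card + F.card := by
    have : (N F).card ≤ W.card + F.card := by
      have : W.card + (N F ∩ F).card = (N F).card := Finset.card_sdiff_add_card_inter (N F) F
      have := Finset.card_le_card (Finset.inter_subset_right (s₁ := N F) (s₂ := F))
      omega
    exact_mod_cast this
  have hFle : (F.card : ℝ) ≤ η * F.card := by
    have : (0 : ℝ) ≤ F.card := Nat.cast_nonneg _
    nlinarith
  have hWpos : (0 : ℝ) < W.card := by linarith
  have hW0 : W.Nonempty := by rw [← Finset.card_pos]; exact_mod_cast hWpos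
  have hWX : W ⊆ X := Finset.sdiff_subset.trans ((Finset.filter_subset _ _).trans hHX)
  obtain ⟨I, hIW, hind, hI1, hIc⟩ := dm' (G := G) i hWX hW0
  have hnF : ∀ j ∈ W, ∃ f ∈ F, (G i).Adj f j := fun j hj =>
    (Finset.mem_filter.1 (Finset.mem_sdiff.1 hj).1).2
  have hF0 : F.Nonempty := by
    obtain ⟨w, hw⟩ := hW0
    obtain ⟨f, hf, -⟩ := hnF w hw
    exact ⟨f, hf⟩
  have hhub := h.hub hi hF hF0 (hIW.trans hWX) hind (fun j hj _ => hnF j (hIW hj))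
  have hIF : I \ F = I := by
    rw [Finset.sdiff_eq_self_iff_disjoint, Finset.disjoint_left]
    exact fun z hz => (Finset.mem_sdiff.1 (hIW hz)).2
  rw [hIF, ← hη] at hhub
  rw [← hη] at hIc
  nlinarith

lemma edges_le (h : Ctx G C X B) {i : ι} (hi : i ∈ C) :
    ∑ u ∈ X, ((nb (G i) X u).card : ℝ) ≤ 0.005776 * X.card * X.card + 8000 * X.card * eta (G i) X := by
  set H := Hv (G i) X with hH
  have hHX : H ⊆ X := Finset.filter_subset _ _
  have hhv := h.heavy hi
  rw [← hH] at hhv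
  have hL : ∀ u ∈ X \ H, (nb (G i) X u).card ≤ 4000 * eta (G i) X := by
    intro u hu
    obtain ⟨h1, h2⟩ := Finset.mem_sdiff.1 hu
    by_contra h3
    exact h2 (Finset.mem_filter.2 ⟨h1, by omega⟩)
  have a1 : ∑ u ∈ X, (nb (G i) X u).card = ∑ u ∈ X \ H, (nb (G i) X u).card +
      ∑ u ∈ H, (nb (G i) X u).card := (Finset.sum_sdiff hHX).symm
  have a2 : ∑ u ∈ H, (nb (G i) X u).card ≤ H.card * H.card + ∑ u ∈ X \ H, (nb (G i) X u).card := by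
    rw [sum_nb_comm (G i) H X, ← Finset.sum_sdiff hHX, add_comm]
    apply add_le_add
    · rw [← smul_eq_mul]
      apply Finset.sum_le_card_nsmul
      intro v hv
      exact Finset.card_filter_le _ _
    · apply Finset.sum_le_sum
      intro v hv
      apply Finset.card_le_card
      intro z hz
      obtain ⟨h1, h2⟩ := mem_nb.1 hz
      exact mem_nb.2 ⟨hHX h1, h2⟩
  have a3 : ∑ u ∈ X \ H, (nb (G i) X u).card ≤ X.card * (4000 * eta (G i) X) := by
    refine (Finset.sum_le_card_nsmul _ _ _ hL).trans ?_
    rw [smul_eq_mul]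
    exact Nat.mul_le_mul_right _ (Finset.card_le_card Finset.sdiff_subset)
  have a4 : ∑ u ∈ X, (nb (G i) X u).card ≤ H.card * H.card + 2 * (X.card * (4000 * eta (G i) X)) := by
    omega
  have a5 : ∑ u ∈ X, ((nb (G i) X u).card : ℝ) ≤ H.card * H.card + 2 * (X.card * (4000 * eta (G i) X)) := by
    exact_mod_cast a4
  have a6 : (0 : ℝ) ≤ H.card := Nat.cast_nonneg _
  nlinarith

lemma sum_deg (h : Ctx G C X B) (v : V) (hv : v ∈ X) {Y : Finset V} (hY : Y ⊆ X) :
    (Y.erase v).card ≤ ∑ i ∈ C, (nb (G i) Y v).card := by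
  refine (Finset.card_le_card ?_).trans Finset.card_biUnion_le
  intro u hu
  obtain ⟨hne, hu⟩ := Finset.mem_erase.1 hu
  obtain ⟨i, hi, hiu⟩ := h.cov v hv u (hY hu) hne.symm
  simp only [Finset.mem_biUnion]
  exact ⟨i, hi, mem_nb.2 ⟨hu, hiu⟩⟩

lemma big2 (h : Ctx G C X B) (hC0 : C.Nonempty) (hB : B = 0.513 ^ (C.card - 3)) :
    150 ≤ C.card := by
  by_contra hlt
  have h13 := h.big hC0
  have hn := h.C_nonempty hC0
  have s1 : (X.card : ℝ) * (X.card - 1) ≤ ∑ i ∈ C, ∑ u ∈ X, ((nb (G i) X u).card : ℝ) := by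
    rw [Finset.sum_comm, ← nsmul_eq_mul]
    apply Finset.card_nsmul_le_sum
    intro u hu
    have := h.sum_deg u hu subset_rfl
    rw [Finset.card_erase_of_mem hu] at this
    have h2 : ((X.card - 1 : ℕ) : ℝ) ≤ ∑ i ∈ C, ((nb (G i) X u).card : ℝ) := by exact_mod_cast this
    rwa [Nat.cast_sub (Finset.card_pos.2 h.nonempty), Nat.cast_one] at h2
  obtain ⟨k, hk⟩ : ∃ k, C.card = 13 + k := ⟨C.card - 13, by omega⟩
  have s2 : ∀ i ∈ C, (8000 : ℝ) * (13 + k) * eta (G i) X ≤ 0.026 * X.card := by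
    intro i hi
    have h1 := h.eta_pow hi
    rw [hB, hk, show 13 + k - 1 = 12 + k by omega, show 13 + k - 3 = 10 + k by omega] at h1
    have h2 := num13 k
    have h3 : (0.513 : ℝ) ^ (11 + k) = 0.513 * 0.513 ^ (10 + k) := by ring
    rw [← h3] at h1
    have h4 : (0 : ℝ) < 2 ^ (12 + k) := by positivity
    have h5 : (2 ^ (12 + k) : ℝ) * (8000 * (13 + k) * eta (G i) X) ≤ 2 ^ (12 + k) * (0.026 * X.card) := by
      calc (2 ^ (12 + k) : ℝ) * (8000 * (13 + k) * eta (G i) X)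
          = (8000 * (13 + k)) * (eta (G i) X * 2 ^ (12 + k)) := by ring
        _ ≤ (8000 * (13 + k)) * (0.513 ^ (11 + k) * X.card) :=
            mul_le_mul_of_nonneg_left h1.le (by positivity)
        _ = (8000 * (13 + k) * 0.513 ^ (11 + k)) * X.card := by ring
        _ ≤ (0.026 * 2 ^ (12 + k)) * X.card := mul_le_mul_of_nonneg_right h2 (Nat.cast_nonneg _)
        _ = _ := by ring
    exact le_of_mul_le_mul_left h5 h4
  have s3 : ∑ i ∈ C, ∑ u ∈ X, ((nb (G i) X u).card : ℝ) ≤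
      C.card * (0.005776 * X.card * X.card + X.card * (0.026 * X.card / (13 + k))) := by
    rw [← nsmul_eq_mul]
    apply Finset.sum_le_card_nsmul
    intro i hi
    refine (h.edges_le hi).trans ?_
    have : 8000 * (eta (G i) X : ℝ) ≤ 0.026 * X.card / (13 + k) := by
      rw [le_div_iff₀ (by positivity)]
      linarith [s2 i hi]
    have := mul_le_mul_of_nonneg_left this (Nat.cast_nonneg X.card)
    linarith
  have s4 : (C.card : ℝ) * (0.005776 * X.card * X.card + X.card * (0.026 * X.card / (13 + k))) =
      C.card * (0.005776 * X.card * X.card) + 0.026 * X.card * X.card := by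
    rw [hk]; push_cast; field_simp
  have s5 : (C.card : ℝ) ≤ 149 := by exact_mod_cast (by omega : C.card ≤ 149)
  have s6 : (C.card : ℝ) * (0.005776 * X.card * X.card) ≤ 149 * (0.005776 * X.card * X.card) :=
    mul_le_mul_of_nonneg_right s5 (by positivity)
  nlinarith

end Ctx
end HW


namespace HW
variable {V : Type*} [DecidableEq V] {ι : Type*} [DecidableEq ι]

lemma reroute_one {G G' : SimpleGraph V} {Z : Finset V} {a b w : V} (hw : w ∉ Z)
    (haw : G.Adj a w) (hbw : G.Adj b w)
    (hG : ∀ u v, G'.Adj u v → G.Adj u v ∨ (u = a ∧ v = b) ∨ (u = b ∧ v = a)) :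
    eta G' Z ≤ eta G (insert w Z) := by
  obtain ⟨B, h1, h2, h3, h4⟩ := cm_eta G' Z
  apply CM.le_eta
  have hwB : ∀ p, w ∉ B p := fun p h => hw (h1 p h)
  refine ⟨fun p => if a ∈ B p then insert w (B p) else B p, ?_, ?_, ?_, ?_⟩
  · intro p
    dsimp only
    split_ifs
    · exact Finset.insert_subset_insert _ (h1 p)
    · exact (h1 p).trans (Finset.subset_insert _ _)
  · intro p
    dsimp only
    split_ifs with ha
    · apply conn_of_cross ⟨w, by simp⟩
      intro A x hx hAx y hy hAy
      by_cases hs : ∃ x ∈ B p, ∃ y ∈ B p, A x ∧ ¬ A y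
      · obtain ⟨x, hx, y, hy, hAx, hAy⟩ := hs
        obtain ⟨u, hu, v, hv, hAu, hAv, huv⟩ := (h2 p).cross A hx hAx hy hAy
        rcases hG u v huv with h | ⟨rfl, rfl⟩ | ⟨rfl, rfl⟩
        · exact ⟨u, by simp [hu], v, by simp [hv], hAu, hAv, h⟩
        · by_cases hAw : A w
          · exact ⟨w, by simp, v, by simp [hv], hAw, hAv, hbw.symm⟩
          · exact ⟨u, by simp [hu], w, by simp, hAu, hAw, haw⟩
        · by_cases hAw : A w
          · exact ⟨w, by simp, v, by simp [hv], hAw, hAv, haw.symm⟩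
          · exact ⟨u, by simp [hu], w, by simp, hAu, hAw, hbw⟩
      · push Not at hs
        by_cases hAw : A w <;> by_cases hAa : A a
        · exfalso
          rcases Finset.mem_insert.1 hy with rfl | hy
          · exact hAy hAw
          · exact hAy (hs a ha y hy hAa)
        · exact ⟨w, by simp, a, by simp [ha], hAw, hAa, haw.symm⟩
        · exact ⟨a, by simp [ha], w, by simp, hAa, hAw, haw⟩
        · exfalso
          rcases Finset.mem_insert.1 hx with rfl | hx
          · exact hAw hAx
          · exact hAa (hs x hx a ha hAx)
    · apply (h2 p).mono
      intro u hu v hv huv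
      rcases hG u v huv with h | ⟨rfl, rfl⟩ | ⟨rfl, rfl⟩
      · exact h
      · exact absurd hu ha
      · exact absurd hv ha
  · intro p q hpq
    dsimp only
    have hd := h3 p q hpq
    split_ifs with ha hb hb
    · exact absurd hb (Finset.disjoint_left.1 hd ha)
    · rw [Finset.disjoint_insert_left]; exact ⟨hwB q, hd⟩
    · rw [Finset.disjoint_insert_right]; exact ⟨hwB p, hd⟩
    · exact hd
  · intro p q hpq
    have hsub : ∀ p, B p ⊆ (if a ∈ B p then insert w (B p) else B p) := by
      intro p
      split_ifs
      · exact Finset.subset_insert _ _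
      · exact subset_rfl
    obtain ⟨u, hu, v, hv, huv⟩ := h4 p q hpq
    rcases hG u v huv with h | ⟨rfl, rfl⟩ | ⟨rfl, rfl⟩
    · exact ⟨u, hsub p hu, v, hsub q hv, h⟩
    · exact ⟨w, by simp [hu], v, hsub q hv, hbw.symm⟩
    · exact ⟨u, hsub p hu, w, by simp [hv], hbw⟩

/-- graph with extra edges -/
def addE (G : SimpleGraph V) (E : Finset (V × V)) : SimpleGraph V :=
  G ⊔ SimpleGraph.fromRel (fun u v => (u, v) ∈ E)

noncomputable def cod (G : SimpleGraph V) (X : Finset V) (a b : V) : ℕ :=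
  (X.filter (fun w => G.Adj a w ∧ G.Adj b w)).card

lemma addE_adj {G : SimpleGraph V} {E : Finset (V × V)} {u v : V} :
    (addE G E).Adj u v ↔ G.Adj u v ∨ (u ≠ v ∧ ((u, v) ∈ E ∨ (v, u) ∈ E)) := by
  simp [addE]

lemma reroute (G : SimpleGraph V) (X : Finset V) (E : Finset (V × V)) : ∀ Z ⊆ X,
    (∀ e ∈ E, Z.card + E.card ≤ cod G X e.1 e.2) → eta (addE G E) Z ≤ eta G X := by
  induction E using Finset.induction_on with
  | empty =>
    intro Z hZ _
    apply eta_mono hZ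
    intro u _ v _ h
    simpa [addE_adj] using h
  | insert e E he ih =>
    intro Z hZ hE
    rw [Finset.card_insert_of_notMem he] at hE
    have h1 := hE e (by simp)
    obtain ⟨w, hw, hwZ⟩ : ∃ w ∈ X.filter (fun w => G.Adj e.1 w ∧ G.Adj e.2 w), w ∉ Z := by
      by_contra hno
      push Not at hno
      have := Finset.card_le_card hno
      unfold cod at h1
      omega
    obtain ⟨hwX, hw1, hw2⟩ := Finset.mem_filter.1 hw
    have h2 : eta (addE G (insert e E)) Z ≤ eta (addE G E) (insert w Z) := by
      apply reroute_one (a := e.1) (b := e.2) hwZ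
      · exact addE_adj.2 (Or.inl hw1)
      · exact addE_adj.2 (Or.inl hw2)
      · intro u v huv
        rw [addE_adj] at huv ⊢
        rcases huv with h | ⟨h, h' | h'⟩
        · exact Or.inl (Or.inl h)
        · rcases Finset.mem_insert.1 h' with h' | h'
          · right; left; rw [← h']; exact ⟨rfl, rfl⟩
          · exact Or.inl (Or.inr ⟨h, Or.inl h'⟩)
        · rcases Finset.mem_insert.1 h' with h' | h'
          · right; right; rw [← h']; exact ⟨rfl, rfl⟩
          · exact Or.inl (Or.inr ⟨h, Or.inr h'⟩)
    refine h2.trans (ih (insert w Z) (Finset.insert_subset hwX hZ) ?_)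
    intro e' he'
    have := hE e' (by simp [he'])
    rw [Finset.card_insert_of_notMem hwZ]
    omega

/-- double counting of badly linked pairs -/
lemma bad_count (G : SimpleGraph V) {W X : Finset V} (hW : W ⊆ X) (R : Finset (V × V)) (M : ℝ)
    (hM : ∀ p ∈ R, (cod G X p.1 p.2 : ℝ) ≤ M) :
    ∑ w ∈ W, ((R.filter (fun p => G.Adj p.1 w ∧ G.Adj p.2 w)).card : ℝ) ≤ R.card * M := by
  have h1 : ∑ w ∈ W, (R.filter (fun p => G.Adj p.1 w ∧ G.Adj p.2 w)).card =
      ∑ p ∈ R, (W.filter (fun w => G.Adj p.1 w ∧ G.Adj p.2 w)).card := by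
    simp only [Finset.card_filter]
    rw [Finset.sum_comm]
  have h2 : ∑ w ∈ W, ((R.filter (fun p => G.Adj p.1 w ∧ G.Adj p.2 w)).card : ℝ) =
      ∑ p ∈ R, ((W.filter (fun w => G.Adj p.1 w ∧ G.Adj p.2 w)).card : ℝ) := by exact_mod_cast h1
  rw [h2, ← nsmul_eq_mul]
  apply Finset.sum_le_card_nsmul
  intro p hp
  refine le_trans ?_ (hM p hp)
  exact_mod_cast Finset.card_le_card (Finset.filter_subset_filter _ hW)

lemma sparse (f : V → V → ℝ) (hf : ∀ a, f a a = 0) (z : ℕ) (hz : 2 ≤ z) : ∀ (k : ℕ) (Y : Finset V),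
    Y.card = z + k → ∃ Z ⊆ Y, Z.card = z ∧
    (∑ a ∈ Z, ∑ b ∈ Z, f a b) * ((Y.card : ℝ) * (Y.card - 1)) ≤
      (∑ a ∈ Y, ∑ b ∈ Y, f a b) * ((z : ℝ) * (z - 1)) := by
  intro k
  induction k with
  | zero => intro Y hY; exact ⟨Y, subset_rfl, by omega, by rw [hY]; simp⟩
  | succ k ih =>
    intro Y hY
    have hYn : Y.Nonempty := by rw [← Finset.card_pos]; omega
    have e1 : ∀ v ∈ Y, ∑ a ∈ Y.erase v, ∑ b ∈ Y.erase v, f a b =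
        ∑ a ∈ Y, ∑ b ∈ Y, f a b - ∑ b ∈ Y, f v b - ∑ a ∈ Y, f a v := by
      intro v hv
      have h1 : ∀ a, ∑ b ∈ Y.erase v, f a b = ∑ b ∈ Y, f a b - f a v := by
        intro a; rw [← Finset.add_sum_erase Y (fun b => f a b) hv]; ring
      simp only [h1]
      rw [Finset.sum_sub_distrib, ← Finset.add_sum_erase Y (fun a => ∑ b ∈ Y, f a b) hv,
        ← Finset.add_sum_erase Y (fun a => f a v) hv, hf]
      ring
    obtain ⟨v, hv, hvle⟩ : ∃ v ∈ Y, (Y.card : ℝ) * ∑ a ∈ Y.erase v, ∑ b ∈ Y.erase v, f a b ≤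
        (Y.card - 2) * ∑ a ∈ Y, ∑ b ∈ Y, f a b := by
      apply Finset.exists_le_of_sum_le hYn
      rw [← Finset.mul_sum, Finset.sum_congr rfl e1]
      simp only [Finset.sum_sub_distrib, Finset.sum_const, nsmul_eq_mul]
      rw [Finset.sum_comm (s := Y) (t := Y) (f := fun x a => f a x)]
      apply le_of_eq; ring
    have hc : (Y.erase v).card = z + k := by rw [Finset.card_erase_of_mem hv]; omega
    obtain ⟨Z, hZ, hZc, hZle⟩ := ih _ hc
    refine ⟨Z, hZ.trans (Finset.erase_subset _ _), hZc, ?_⟩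
    rw [hc] at hZle
    rw [hY] at hvle ⊢
    push_cast at *
    have hz' : (2 : ℝ) ≤ z := by exact_mod_cast hz
    have hk : (0 : ℝ) ≤ k := Nat.cast_nonneg _
    have hpos : (0 : ℝ) < z + k - 1 := by linarith
    set WZ := ∑ a ∈ Z, ∑ b ∈ Z, f a b
    set WY := ∑ a ∈ Y, ∑ b ∈ Y, f a b
    set WE := ∑ a ∈ Y.erase v, ∑ b ∈ Y.erase v, f a b
    have hzz : (0 : ℝ) ≤ z * (z - 1) := by nlinarith
    have h1 := mul_le_mul_of_nonneg_right hvle hzz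
    have h2 := mul_le_mul_of_nonneg_right hZle (by linarith : (0 : ℝ) ≤ z + (k + 1))
    have h3 : (z + k - 1 : ℝ) * (WZ * ((z + (k + 1)) * (z + (k + 1) - 1))) ≤
        (z + k - 1) * (WY * (z * (z - 1))) := by nlinarith
    exact le_of_mul_le_mul_left h3 hpos

namespace Ctx
variable {G : ι → SimpleGraph V} {C : Finset ι} {X : Finset V} {B : ℝ}

lemma density (h : Ctx G C X B) (hC0 : C.Nonempty) (T : ℕ)
    (hT : C.card * T + C.card * (C.card * T) ^ 2 * (T + T ^ 2) < X.card) :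
    ∃ c ∈ C, T ≤ eta (G c) X := by
  obtain ⟨U, hUX, hUc⟩ := Finset.exists_subset_card_eq (s := X) (n := C.card * T)
    (by omega)
  let R : ι → Finset (V × V) := fun c => (U ×ˢ U).filter (fun p => cod (G c) X p.1 p.2 < T + T ^ 2)
  have hsum : ∑ w ∈ X \ U, ∑ c ∈ C, (((R c).filter (fun p => (G c).Adj p.1 w ∧ (G c).Adj p.2 w)).card : ℝ)
      < ∑ w ∈ X \ U, 1 := by
    rw [Finset.sum_comm]
    have h1 : ∀ c ∈ C, ∑ w ∈ X \ U, (((R c).filter (fun p => (G c).Adj p.1 w ∧ (G c).Adj p.2 w)).card : ℝ)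
        ≤ (C.card * T) ^ 2 * (T + T ^ 2) := by
      intro c hc
      refine (bad_count (G c) Finset.sdiff_subset (R c) ((T + T ^ 2 : ℕ) : ℝ) ?_).trans ?_
      · intro p hp
        exact_mod_cast (Finset.mem_filter.1 hp).2.le
      · have : (R c).card ≤ (C.card * T) ^ 2 := by
          refine (Finset.card_filter_le _ _).trans ?_
          rw [Finset.card_product, hUc, sq]
        push_cast
        apply mul_le_mul_of_nonneg_right _ (by positivity)
        exact_mod_cast this
    refine (Finset.sum_le_sum h1).trans_lt ?_
    rw [Finset.sum_const, Finset.sum_const, nsmul_eq_mul, nsmul_eq_mul, mul_one]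
    have h2 := Finset.card_sdiff_add_card_eq_card hUX
    have h3 : C.card * ((C.card * T) ^ 2 * (T + T ^ 2)) < (X \ U).card := by
      rw [← mul_assoc]; omega
    exact_mod_cast h3
  obtain ⟨w, hw, hwlt⟩ := Finset.exists_lt_of_sum_lt hsum
  obtain ⟨hwX, hwU⟩ := Finset.mem_sdiff.1 hw
  have hw0 : ∀ c ∈ C, (R c).filter (fun p => (G c).Adj p.1 w ∧ (G c).Adj p.2 w) = ∅ := by
    intro c hc
    rw [← Finset.card_eq_zero]
    have h1 : ∑ c ∈ C, ((R c).filter (fun p => (G c).Adj p.1 w ∧ (G c).Adj p.2 w)).card < 1 := by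
      exact_mod_cast hwlt
    have := Finset.single_le_sum (f := fun c => ((R c).filter (fun p => (G c).Adj p.1 w ∧ (G c).Adj p.2 w)).card)
      (fun _ _ => Nat.zero_le _) hc
    omega
  have hdeg := h.sum_deg w hwX hUX
  rw [Finset.erase_eq_of_notMem hwU, hUc] at hdeg
  obtain ⟨c, hc, hcT⟩ : ∃ c ∈ C, T ≤ (nb (G c) U w).card := by
    apply Finset.exists_le_of_sum_le hC0
    simpa using hdeg
  obtain ⟨Z, hZ, hZc⟩ := Finset.exists_subset_card_eq hcT
  refine ⟨c, hc, ?_⟩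
  have hZU : Z ⊆ U := hZ.trans (Finset.filter_subset _ _)
  rw [← hZc]
  refine le_trans (clique_le_eta (G := addE (G c) (Z ×ˢ Z)) subset_rfl ?_)
    (reroute (G c) X (Z ×ˢ Z) Z (hZU.trans hUX) ?_)
  · intro u hu v hv huv
    exact addE_adj.2 (Or.inr ⟨huv, Or.inl (by simp [hu, hv])⟩)
  · rintro ⟨a, b⟩ hab
    obtain ⟨ha, hb⟩ := Finset.mem_product.1 hab
    dsimp only at ha hb ⊢
    by_contra hlt
    rw [Finset.card_product, hZc] at hlt
    have : (a, b) ∈ (R c).filter (fun p => (G c).Adj p.1 w ∧ (G c).Adj p.2 w) := by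
      simp only [R, Finset.mem_filter, Finset.mem_product]
      refine ⟨⟨⟨hZU ha, hZU hb⟩, by rw [sq]; omega⟩, ((mem_nb.1 (hZ ha)).2).symm, ((mem_nb.1 (hZ hb)).2).symm⟩
    rw [hw0 c hc] at this
    simp at this

end Ctx
end HW


namespace HW
variable {V : Type*} [DecidableEq V] {ι : Type*} [DecidableEq ι]

set_option exponentiation.threshold 2000 in
lemma num150 (k : ℕ) : ((768 * 10 ^ 32 * (150 + k) ^ 23 : ℕ) : ℝ) * 0.513 ^ (148 + k) ≤ 2 ^ (149 + k) := by
  induction k with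
  | zero => norm_num
  | succ k ih =>
    push_cast at ih ⊢
    have h1 : (0.513 : ℝ) ^ (148 + (k + 1)) = 0.513 ^ (148 + k) * 0.513 := by ring
    have h2 : (2 : ℝ) ^ (149 + (k + 1)) = 2 ^ (149 + k) * 2 := by ring
    rw [h1, h2]
    have h4 : (0 : ℝ) ≤ k := Nat.cast_nonneg _
    have h5 : ((150 : ℝ) + (k + 1)) ^ 23 ≤ 2 * (150 + k) ^ 23 := by
      calc ((150 : ℝ) + (k + 1)) ^ 23 ≤ ((151 / 150) * (150 + k)) ^ 23 :=
            pow_le_pow_left₀ (by positivity) (by linarith) _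
        _ = (151 / 150) ^ 23 * (150 + k) ^ 23 := by rw [mul_pow]
        _ ≤ 2 * (150 + k) ^ 23 := by
            apply mul_le_mul_of_nonneg_right _ (by positivity)
            norm_num
    have h6 : (0 : ℝ) ≤ 0.513 ^ (148 + k) := by positivity
    have h7 : (0 : ℝ) ≤ (150 + k) ^ 23 * 0.513 ^ (148 + k) := by positivity
    calc (76800000000000000000000000000000000 * (150 + (k + 1)) ^ 23 * (0.513 ^ (148 + k) * 0.513) : ℝ)
        = (76800000000000000000000000000000000 * 0.513 ^ (148 + k) * 0.513) * (150 + (k + 1)) ^ 23 := by ring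
      _ ≤ (76800000000000000000000000000000000 * 0.513 ^ (148 + k) * 0.513) * (2 * (150 + k) ^ 23) :=
          mul_le_mul_of_nonneg_left h5 (by positivity)
      _ = (76800000000000000000000000000000000 * (150 + k) ^ 23 * 0.513 ^ (148 + k)) * 1.026 := by ring
      _ ≤ 2 ^ (149 + k) * 1.026 := mul_le_mul_of_nonneg_right ih (by norm_num)
      _ ≤ 2 ^ (149 + k) * 2 := mul_le_mul_of_nonneg_left (by norm_num) (by positivity)

/-- edges and unlinked edges, as ordered pairs -/
noncomputable def P1 (G1 : SimpleGraph V) (Y : Finset V) : Finset (V × V) :=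
  (Y ×ˢ Y).filter (fun p => G1.Adj p.1 p.2)

noncomputable def Pu (G1 Gc : SimpleGraph V) (X : Finset V) (Λ : ℝ) (Y : Finset V) : Finset (V × V) :=
  (Y ×ˢ Y).filter (fun p => G1.Adj p.1 p.2 ∧ (cod Gc X p.1 p.2 : ℝ) < Λ)

lemma card_P1 (G1 : SimpleGraph V) (Y : Finset V) : (P1 G1 Y).card = ∑ a ∈ Y, (nb G1 Y a).card := by
  simp only [P1, nb, Finset.card_filter]
  rw [Finset.sum_product]

noncomputable def wt (G1 Gc : SimpleGraph V) (X : Finset V) (Λ M : ℝ) (a b : V) : ℝ :=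
  (if G1.Adj a b then 1 else 0) + M * (if G1.Adj a b ∧ (cod Gc X a b : ℝ) < Λ then 1 else 0)

lemma wt_sum (G1 Gc : SimpleGraph V) (X : Finset V) (Λ M : ℝ) (Y : Finset V) :
    ∑ a ∈ Y, ∑ b ∈ Y, wt G1 Gc X Λ M a b = (P1 G1 Y).card + M * (Pu G1 Gc X Λ Y).card := by
  unfold wt P1 Pu
  simp only [Finset.card_filter, Nat.cast_sum, Nat.cast_ite, Nat.cast_one, Nat.cast_zero]
  rw [Finset.sum_product, Finset.sum_product, Finset.mul_sum, ← Finset.sum_add_distrib]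
  apply Finset.sum_congr rfl
  intro a _
  rw [Finset.mul_sum, ← Finset.sum_add_distrib]

/-- sparse subset with both counts controlled -/
lemma pick (G1 Gc : SimpleGraph V) (X : Finset V) (Λ M : ℝ) (hM : 0 ≤ M) (Y : Finset V) (z : ℕ)
    (hz : 2 ≤ z) (hzY : z ≤ Y.card) : ∃ Z ⊆ Y, Z.card = z ∧
    ((P1 G1 Z).card + M * (Pu G1 Gc X Λ Z).card : ℝ) * (Y.card : ℝ) ^ 2 ≤
      ((P1 G1 Y).card + M * (Pu G1 Gc X Λ Y).card) * (z : ℝ) ^ 2 := by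
  obtain ⟨Z, hZ, hZc, h⟩ := sparse (wt G1 Gc X Λ M) (by intro a; simp [wt]) z hz (Y.card - z) Y (by omega)
  refine ⟨Z, hZ, hZc, ?_⟩
  rw [wt_sum, wt_sum] at h
  set W := ((P1 G1 Z).card + M * (Pu G1 Gc X Λ Z).card : ℝ)
  set W' := ((P1 G1 Y).card + M * (Pu G1 Gc X Λ Y).card : ℝ)
  have hW' : 0 ≤ W' := by positivity
  have h1 : (2 : ℝ) ≤ z := by exact_mod_cast hz
  have h2 : (z : ℝ) ≤ Y.card := by exact_mod_cast hzY
  set N : ℝ := (Y.card : ℝ) with hN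
  set s : ℝ := (z : ℝ) with hs
  have h3 : W * (N * (N - 1)) * N ≤ W' * (s * (s - 1)) * N := mul_le_mul_of_nonneg_right h (by linarith)
  have h4 : (s - 1) * N ≤ s * (N - 1) := by nlinarith
  have h5 : W' * s * ((s - 1) * N) ≤ W' * s * (s * (N - 1)) :=
    mul_le_mul_of_nonneg_left h4 (by positivity)
  have h6 : (N - 1) * (W * N ^ 2) ≤ (N - 1) * (W' * s ^ 2) := by nlinarith
  exact le_of_mul_le_mul_left h6 (by linarith)

lemma single_le' (s : Finset ι) (f : ι → ℕ) {c : ι} (hc : c ∈ s) :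
    (f c : ℝ) ≤ ∑ c ∈ s, (f c : ℝ) :=
  Finset.single_le_sum (f := fun c => (f c : ℝ)) (fun _ _ => Nat.cast_nonneg _) hc

namespace Ctx
variable {G : ι → SimpleGraph V} {C : Finset ι} {X : Finset V} {B : ℝ}

lemma n_big (h : Ctx G C X B) (hB : B = 0.513 ^ (C.card - 3)) (h150 : 150 ≤ C.card) {i : ι}
    (hi : i ∈ C) : eta (G i) X * (768 * 10 ^ 32 * C.card ^ 23) ≤ X.card := by
  obtain ⟨k, hk⟩ : ∃ k, C.card = 150 + k := ⟨C.card - 150, by omega⟩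
  have h1 := h.eta_pow hi
  rw [hB, hk, show 150 + k - 1 = 149 + k by omega, show 150 + k - 3 = 147 + k by omega] at h1
  have h3 : (0.513 : ℝ) ^ (148 + k) = 0.513 * 0.513 ^ (147 + k) := by ring
  rw [← h3] at h1
  have h2 := num150 k
  rw [hk]
  have h4 : (0.513 : ℝ) ^ (148 + k) * ((eta (G i) X * (768 * 10 ^ 32 * (150 + k) ^ 23) : ℕ) : ℝ) ≤
      0.513 ^ (148 + k) * (X.card : ℝ) := by
    rw [Nat.cast_mul]
    have := mul_le_mul_of_nonneg_left h2 (Nat.cast_nonneg (α := ℝ) (eta (G i) X))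
    linarith
  have h5 := le_of_mul_le_mul_left h4 (by positivity)
  exact_mod_cast h5

lemma link (h : Ctx G C X B) (c1 : ι) (hc1 : c1 ∈ C) (Λ : ℝ) (hΛ : 0 ≤ Λ) (hn : (100 : ℝ) ≤ X.card)
    (ht : (4000 : ℝ) * eta (G c1) X ≤ 0.1 * X.card) (hr : 2 ≤ C.card) :
    ∃ c ∈ C.erase c1, ∃ Y ⊆ X, 0.8 * (X.card : ℝ) ≤ C.card * Y.card ∧
      ((P1 (G c1) Y).card : ℝ) ≤ Y.card * (4000 * eta (G c1) X) ∧
      ((Pu (G c1) (G c) X Λ Y).card : ℝ) ≤ C.card * (4000 * eta (G c1) X) * Λ := by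
  set L := X \ Hv (G c1) X with hL
  have hLX : L ⊆ X := Finset.sdiff_subset
  have hLc : (0.924 : ℝ) * X.card ≤ L.card := by
    have h1 := h.heavy hc1
    have h2 : (L.card : ℝ) + (Hv (G c1) X).card = X.card := by
      exact_mod_cast Finset.card_sdiff_add_card_eq_card (Finset.filter_subset _ _)
    linarith
  have hLd : ∀ u ∈ L, (nb (G c1) X u).card ≤ 4000 * eta (G c1) X := by
    intro u hu
    obtain ⟨h1, h2⟩ := Finset.mem_sdiff.1 hu
    by_contra h3
    exact h2 (Finset.mem_filter.2 ⟨h1, by omega⟩)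
  have hP1 : ∀ Y ⊆ L, (P1 (G c1) Y).card ≤ Y.card * (4000 * eta (G c1) X) := by
    intro Y hY
    rw [card_P1, ← smul_eq_mul]
    apply Finset.sum_le_card_nsmul
    intro u hu
    exact (Finset.card_le_card (Finset.filter_subset_filter _ (hY.trans hLX))).trans (hLd u (hY hu))
  have hL0 : L.Nonempty := by
    rw [← Finset.card_pos]
    have : (0 : ℝ) < L.card := by linarith
    exact_mod_cast this
  have hsum : ∑ w ∈ L, ∑ c ∈ C.erase c1, (((Pu (G c1) (G c) X Λ L).filter
      (fun p => (G c).Adj p.1 w ∧ (G c).Adj p.2 w)).card : ℝ) ≤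
      ∑ w ∈ L, C.card * (4000 * eta (G c1) X) * Λ := by
    rw [Finset.sum_comm]
    have h1 : ∀ c ∈ C.erase c1, ∑ w ∈ L, (((Pu (G c1) (G c) X Λ L).filter
      (fun p => (G c).Adj p.1 w ∧ (G c).Adj p.2 w)).card : ℝ) ≤ L.card * (4000 * eta (G c1) X) * Λ := by
      intro c hc
      refine (bad_count (G c) hLX (Pu (G c1) (G c) X Λ L) Λ ?_).trans ?_
      · intro p hp
        exact (Finset.mem_filter.1 hp).2.2.le
      · apply mul_le_mul_of_nonneg_right _ hΛ
        have h2 : (Pu (G c1) (G c) X Λ L).card ≤ (P1 (G c1) L).card := by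
          apply Finset.card_le_card
          intro p hp
          obtain ⟨a1, a2⟩ := Finset.mem_filter.1 hp
          exact Finset.mem_filter.2 ⟨a1, a2.1⟩
        exact_mod_cast h2.trans (hP1 L subset_rfl)
    refine (Finset.sum_le_card_nsmul _ _ _ h1).trans ?_
    rw [Finset.sum_const, nsmul_eq_mul, nsmul_eq_mul]
    have h2 : ((C.erase c1).card : ℝ) ≤ C.card := by
      exact_mod_cast Finset.card_le_card (Finset.erase_subset _ _)
    calc ((C.erase c1).card : ℝ) * (L.card * (4000 * eta (G c1) X) * Λ)
        ≤ C.card * (L.card * (4000 * eta (G c1) X) * Λ) := mul_le_mul_of_nonneg_right h2 (by positivity)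
      _ = _ := by ring
  obtain ⟨w, hw, hwle⟩ := Finset.exists_le_of_sum_le hL0 hsum
  have hrpos : (0 : ℝ) < C.card := by
    have : 0 < C.card := by omega
    exact_mod_cast this
  obtain ⟨c, hc, hcN⟩ : ∃ c ∈ C.erase c1, 0.8 * (X.card : ℝ) / C.card ≤ ((nb (G c) L w).card : ℝ) := by
    apply Finset.exists_le_of_sum_le
    · rw [← Finset.card_pos, Finset.card_erase_of_mem hc1]; omega
    have h1 := h.sum_deg w (hLX hw) hLX
    rw [Finset.card_erase_of_mem hw, ← Finset.add_sum_erase C _ hc1] at h1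
    have h2 : (nb (G c1) L w).card ≤ 4000 * eta (G c1) X :=
      (Finset.card_le_card (Finset.filter_subset_filter _ hLX)).trans (hLd w hw)
    have h3 : L.card ≤ 1 + 4000 * eta (G c1) X + ∑ c ∈ C.erase c1, (nb (G c) L w).card := by omega
    have h4 : (L.card : ℝ) ≤ 1 + 4000 * eta (G c1) X + ∑ c ∈ C.erase c1, ((nb (G c) L w).card : ℝ) := by
      exact_mod_cast h3
    have h5 : ∑ c ∈ C.erase c1, 0.8 * (X.card : ℝ) / C.card ≤ 0.8 * X.card := by
      rw [Finset.sum_const, nsmul_eq_mul]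
      have h2 : ((C.erase c1).card : ℝ) ≤ C.card := by
        exact_mod_cast Finset.card_le_card (Finset.erase_subset _ _)
      calc ((C.erase c1).card : ℝ) * (0.8 * (X.card : ℝ) / C.card) ≤
          C.card * (0.8 * (X.card : ℝ) / C.card) := mul_le_mul_of_nonneg_right h2 (by positivity)
        _ = _ := by field_simp
    linarith
  refine ⟨c, hc, nb (G c) L w, (Finset.filter_subset _ _).trans hLX, ?_, ?_, ?_⟩
  · rw [div_le_iff₀ hrpos] at hcN
    linarith
  · have := hP1 (nb (G c) L w) (Finset.filter_subset _ _)
    exact_mod_cast this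
  · refine le_trans ?_ hwle
    have hone := single_le' (C.erase c1) (fun c => ((Pu (G c1) (G c) X Λ L).filter
      (fun p => (G c).Adj p.1 w ∧ (G c).Adj p.2 w)).card) hc
    refine le_trans ?_ hone
    have : (Pu (G c1) (G c) X Λ (nb (G c) L w)).card ≤ ((Pu (G c1) (G c) X Λ L).filter
      (fun p => (G c).Adj p.1 w ∧ (G c).Adj p.2 w)).card := by
      apply Finset.card_le_card
      intro p hp
      obtain ⟨a1, a2⟩ := Finset.mem_filter.1 hp
      obtain ⟨b1, b2⟩ := Finset.mem_product.1 a1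
      obtain ⟨d1, d2⟩ := mem_nb.1 b1
      obtain ⟨d3, d4⟩ := mem_nb.1 b2
      exact Finset.mem_filter.2 ⟨Finset.mem_filter.2 ⟨Finset.mem_product.2 ⟨d1, d3⟩, a2⟩, d2.symm, d4.symm⟩
    exact_mod_cast this

end Ctx
end HW


namespace HW
variable {V : Type*} [DecidableEq V] {ι : Type*} [DecidableEq ι]

lemma num8 (R n t N z W q : ℝ) (hq : 0 < q) (ht : 0 < t) (hR : 0 ≤ R) (hn : n = q * t) (hW : 0 ≤ W)
    (hN : 0.8 * n ≤ R * N) (hz0 : 0 ≤ z) (hz : z ≤ 0.601 * q) (h : W * N ^ 2 ≤ 5920 * t * n * z ^ 2) :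
    W ≤ 3600 * R ^ 2 * q := by
  have hn0 : 0 < n := by rw [hn]; positivity
  have h1 : (0.8 * n) ^ 2 ≤ (R * N) ^ 2 := pow_le_pow_left₀ (by positivity) hN 2
  have h2 : z ^ 2 ≤ (0.601 * q) ^ 2 := pow_le_pow_left₀ hz0 hz 2
  have h3 : W * (0.8 * n) ^ 2 ≤ R ^ 2 * (5920 * t * n * (0.601 * q) ^ 2) := by
    calc W * (0.8 * n) ^ 2 ≤ W * (R * N) ^ 2 := mul_le_mul_of_nonneg_left h1 hW
      _ = R ^ 2 * (W * N ^ 2) := by ring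
      _ ≤ R ^ 2 * (5920 * t * n * z ^ 2) := mul_le_mul_of_nonneg_left h (by positivity)
      _ ≤ _ := by gcongr
  have h4 : (q ^ 2 * t ^ 2) * (0.64 * W) ≤ (q ^ 2 * t ^ 2) * (5920 * 0.601 ^ 2 * R ^ 2 * q) := by
    rw [hn] at h3
    linarith [h3]
  have h5 := le_of_mul_le_mul_left h4 (by positivity)
  have h6 : 0 ≤ R ^ 2 * q := by positivity
  norm_num at h5
  linarith

lemma numT (r n t : ℕ) (hr : 150 ≤ r) (ht : 2 ≤ t) (h : t * (768 * 10 ^ 32 * r ^ 23) ≤ n) :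
    r * (4 * 10 ^ 8 * r ^ 5) + r * (r * (4 * 10 ^ 8 * r ^ 5)) ^ 2 *
      ((4 * 10 ^ 8 * r ^ 5) + (4 * 10 ^ 8 * r ^ 5) ^ 2) < n := by
  set T := 4 * 10 ^ 8 * r ^ 5 with hT
  have hr0 : 0 < r := by omega
  have hT1 : 1 ≤ T := by
    have : 0 < T := by positivity
    exact this
  have e1 : r * T ≤ r ^ 3 * T ^ 4 := by
    have a : r ≤ r ^ 3 := Nat.le_self_pow (by norm_num) r
    have b : T ≤ T ^ 4 := Nat.le_self_pow (by norm_num) T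
    exact Nat.mul_le_mul a b
  have e2 : T + T ^ 2 ≤ 2 * T ^ 2 := by
    have b : T ≤ T ^ 2 := Nat.le_self_pow (by norm_num) T
    omega
  have e3 : r * (r * T) ^ 2 * (T + T ^ 2) ≤ 2 * (r ^ 3 * T ^ 4) := by
    calc r * (r * T) ^ 2 * (T + T ^ 2) ≤ r * (r * T) ^ 2 * (2 * T ^ 2) := Nat.mul_le_mul_left _ e2
      _ = _ := by ring
  have e4 : 3 * (r ^ 3 * T ^ 4) = 768 * 10 ^ 32 * r ^ 23 := by rw [hT]; ring
  have e5 : 0 < 768 * 10 ^ 32 * r ^ 23 := by positivity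
  have e6 : 2 * (768 * 10 ^ 32 * r ^ 23) ≤ t * (768 * 10 ^ 32 * r ^ 23) := Nat.mul_le_mul_right _ ht
  omega

namespace Ctx
variable {G : ι → SimpleGraph V} {C : Finset ι} {X : Finset V} {B : ℝ}

/-- final rerouting step -/
lemma fin_step (h : Ctx G C X B) {c1 c : ι} (hc1 : c1 ∈ C) (hc : c ∈ C.erase c1) {Z : Finset V}
    (hZ : Z ⊆ X) (hE : ∀ e ∈ P1 (G c1) Z, Z.card + (P1 (G c1) Z).card ≤ cod (G c) X e.1 e.2) :
    (eta (G c1) X : ℝ) * (B * Z.card) < 0.513 * B * X.card := by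
  set E := P1 (G c1) Z with hEd
  set G' : ι → SimpleGraph V := Function.update G c (addE (G c) E) with hG'
  have hcov : Cov G' (C.erase c1) Z := by
    intro u hu v hv huv
    obtain ⟨i, hi, hadj⟩ := h.cov u (hZ hu) v (hZ hv) huv
    by_cases h1 : i = c1
    · subst h1
      refine ⟨c, hc, ?_⟩
      rw [hG', Function.update_self, addE_adj]
      exact Or.inr ⟨huv, Or.inl (Finset.mem_filter.2 ⟨Finset.mem_product.2 ⟨hu, hv⟩, hadj⟩)⟩
    · refine ⟨i, Finset.mem_erase.2 ⟨h1, hi⟩, ?_⟩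
      by_cases h2 : i = c
      · subst h2
        rw [hG', Function.update_self, addE_adj]
        exact Or.inl hadj
      · rw [hG', Function.update_of_ne h2]
        exact hadj
  have h1 := h.ihr G' c1 hc1 Z hcov
  have h2 : PP G' (C.erase c1) Z ≤ PP G (C.erase c1) X := by
    apply PP_mono
    intro i hi
    by_cases h2 : i = c
    · subst h2
      rw [hG', Function.update_self]
      exact reroute (G i) X E Z hZ hE
    · rw [hG', Function.update_of_ne h2]
      exact eta_mono_set _ hZ
  have h3 := h.lt
  rw [PP_erase G hc1] at h3
  exact (mul_le_mul_of_nonneg_left (h1.trans h2) (Nat.cast_nonneg _)).trans_lt h3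

lemma big3 (h : Ctx G C X B) (hC0 : C.Nonempty) (hB : B = 0.513 ^ (C.card - 3)) : False := by
  have h150 := h.big2 hC0 hB
  obtain ⟨i0, hi0⟩ := hC0
  have hnum := numT C.card X.card (eta (G i0) X) h150 (h.two_le hi0) (h.n_big hB h150 hi0)
  obtain ⟨c1, hc1, hT⟩ := h.density ⟨i0, hi0⟩ _ hnum
  have hnb := h.n_big hB h150 hc1
  have hnbR : (eta (G c1) X : ℝ) * (768 * 10 ^ 32 * (C.card : ℝ) ^ 23) ≤ X.card := by exact_mod_cast hnb
  have hTR : 4 * 10 ^ 8 * (C.card : ℝ) ^ 5 ≤ (eta (G c1) X : ℝ) := by exact_mod_cast hT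
  have hRR : (150 : ℝ) ≤ C.card := by exact_mod_cast h150
  clear hnum hT hnb
  set R : ℝ := (C.card : ℝ) with hR
  set t : ℝ := (eta (G c1) X : ℝ) with ht
  set n : ℝ := (X.card : ℝ) with hn
  clear_value R t n
  have hR0 : 0 < R := by linarith
  have hR5 : (1 : ℝ) ≤ R ^ 5 := one_le_pow₀ (by linarith)
  have hR23 : (1 : ℝ) ≤ R ^ 23 := one_le_pow₀ (by linarith)
  have ht0 : 1 ≤ t := by linarith
  obtain ⟨q, hq⟩ : ∃ q, q = n / t := ⟨_, rfl⟩
  have hnq : n = q * t := by rw [hq]; field_simp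
  have hq0 : 768 * 10 ^ 32 ≤ q := by
    rw [hq, le_div_iff₀ (by linarith)]
    refine le_trans ?_ hnbR
    have : t * (768 * 10 ^ 32) * 1 ≤ t * (768 * 10 ^ 32) * R ^ 23 :=
      mul_le_mul_of_nonneg_left hR23 (by positivity)
    linarith
  have hq1 : (1000000 : ℝ) ≤ q := by
    refine le_trans ?_ hq0
    norm_num
  have hqR : 768 * 10 ^ 32 * R ^ 23 ≤ q := by
    rw [hq, le_div_iff₀ (by linarith)]
    linarith
  have hqt : 1000000 * t ≤ n := by
    rw [hnq]; exact mul_le_mul_of_nonneg_right hq1 (by linarith)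
  have hn0 : 0 < n := by linarith
  have ht00 : 0 < t := by linarith
  have hL0 : 0 ≤ n / (100000 * R ^ 3) := by positivity
  obtain ⟨c, hc, Y, hYX, hYc, hY1, hYu⟩ := h.link c1 hc1 (n / (100000 * R ^ 3)) hL0
    (by rw [← hn]; linarith) (by rw [← hn, ← ht]; linarith) (by omega)
  rw [← hn, ← hR] at hYc
  rw [← ht] at hY1
  rw [← ht, ← hR] at hYu
  have hYn : (Y.card : ℝ) ≤ n := by rw [hn]; exact_mod_cast Finset.card_le_card hYX
  obtain ⟨z, hz⟩ : ∃ z, z = ⌈0.6 * q⌉₊ := ⟨_, rfl⟩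
  have hz1 : 0.6 * q ≤ z := by rw [hz]; exact Nat.le_ceil _
  have hz2 : (z : ℝ) ≤ 0.601 * q := by
    have : (z : ℝ) < 0.6 * q + 1 := by rw [hz]; exact Nat.ceil_lt_add_one (by linarith)
    linarith
  have hzY : z ≤ Y.card := by
    have : R * (z : ℝ) ≤ R * Y.card := by
      refine le_trans ?_ hYc
      have hRt : R ≤ t := by
        have : R ≤ R ^ 5 := le_self_pow₀ (by linarith) (by norm_num)
        linarith
      calc R * (z : ℝ) ≤ t * (0.601 * q) := mul_le_mul hRt hz2 (by positivity) (by linarith)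
        _ = 0.601 * n := by rw [hnq]; ring
        _ ≤ 0.8 * n := by linarith
    have := le_of_mul_le_mul_left this (by linarith)
    exact_mod_cast this
  have hz3 : 2 ≤ z := by
    have : (2 : ℝ) ≤ z := by linarith
    exact_mod_cast this
  obtain ⟨Z0, hZ0, hZ0c, hpick⟩ := pick (G c1) (G c) X (n / (100000 * R ^ 3)) (48000 * R ^ 2)
    (by positivity) Y z hz3 hzY
  obtain ⟨Λ, hΛ⟩ : ∃ Λ, Λ = n / (100000 * R ^ 3) := ⟨_, rfl⟩
  rw [← hΛ] at hpick hYu hL0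
  have hWY : ((P1 (G c1) Y).card + 48000 * R ^ 2 * (Pu (G c1) (G c) X Λ Y).card : ℝ) ≤ 5920 * t * n := by
    have a1 : ((P1 (G c1) Y).card : ℝ) ≤ n * (4000 * t) :=
      hY1.trans (mul_le_mul_of_nonneg_right hYn (by positivity))
    have a2 : 48000 * R ^ 2 * ((Pu (G c1) (G c) X Λ Y).card : ℝ) ≤ 48000 * R ^ 2 * (R * (4000 * t) * Λ) :=
      mul_le_mul_of_nonneg_left hYu (by positivity)
    have a3 : 48000 * R ^ 2 * (R * (4000 * t) * Λ) = 1920 * t * n := by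
      rw [hΛ]
      field_simp
      norm_num
    linarith
  have hW : ((P1 (G c1) Z0).card + 48000 * R ^ 2 * (Pu (G c1) (G c) X Λ Z0).card : ℝ) ≤ 3600 * R ^ 2 * q := by
    refine num8 R n t Y.card z _ q (by linarith) (by linarith) (by linarith) hnq
      (add_nonneg (Nat.cast_nonneg _) (mul_nonneg (by positivity) (Nat.cast_nonneg _))) hYc
      (Nat.cast_nonneg _) hz2 (hpick.trans ?_)
    exact mul_le_mul_of_nonneg_right hWY (by positivity)
  have hPu : ((Pu (G c1) (G c) X Λ Z0).card : ℝ) ≤ 0.075 * q := by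
    have a1 : (48000 * R ^ 2) * ((Pu (G c1) (G c) X Λ Z0).card : ℝ) ≤ (48000 * R ^ 2) * (0.075 * q) := by
      have : (0 : ℝ) ≤ (P1 (G c1) Z0).card := Nat.cast_nonneg _
      linarith
    exact le_of_mul_le_mul_left a1 (by positivity)
  have hP1 : ((P1 (G c1) Z0).card : ℝ) ≤ 3600 * R ^ 2 * q := by
    have : (0 : ℝ) ≤ 48000 * R ^ 2 * (Pu (G c1) (G c) X Λ Z0).card :=
      mul_nonneg (by positivity) (Nat.cast_nonneg _)
    linarith
  obtain ⟨Z, hZ⟩ : ∃ Z, Z = Z0 \ (Pu (G c1) (G c) X Λ Z0).image Prod.fst := ⟨_, rfl⟩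
  have hZZ0 : Z ⊆ Z0 := by rw [hZ]; exact Finset.sdiff_subset
  have hZc : 0.525 * q ≤ (Z.card : ℝ) := by
    have a1 : Z0.card ≤ Z.card + (Pu (G c1) (G c) X Λ Z0).card := by
      have b1 := Finset.le_card_sdiff ((Pu (G c1) (G c) X Λ Z0).image Prod.fst) Z0
      have b2 : ((Pu (G c1) (G c) X Λ Z0).image Prod.fst).card ≤ _ := Finset.card_image_le
      rw [← hZ] at b1
      omega
    have a2 : (z : ℝ) ≤ Z.card + (Pu (G c1) (G c) X Λ Z0).card := by
      rw [← hZ0c]; exact_mod_cast a1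
    linarith
  have hfin : ∀ e ∈ P1 (G c1) Z, Z.card + (P1 (G c1) Z).card ≤ cod (G c) X e.1 e.2 := by
    intro e he
    obtain ⟨he1, he2⟩ := Finset.mem_filter.1 he
    obtain ⟨hea, heb⟩ := Finset.mem_product.1 he1
    have a1 : Λ ≤ (cod (G c) X e.1 e.2 : ℝ) := by
      by_contra hlt
      push Not at hlt
      have hmem : e ∈ Pu (G c1) (G c) X Λ Z0 :=
        Finset.mem_filter.2 ⟨Finset.mem_product.2 ⟨hZZ0 hea, hZZ0 heb⟩, he2, hlt⟩
      rw [hZ] at hea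
      exact (Finset.mem_sdiff.1 hea).2 (Finset.mem_image_of_mem _ hmem)
    have a2 : (Z.card : ℝ) ≤ 0.601 * q := by
      refine le_trans ?_ hz2
      rw [← hZ0c]
      exact_mod_cast Finset.card_le_card hZZ0
    have a3 : ((P1 (G c1) Z).card : ℝ) ≤ 3600 * R ^ 2 * q := by
      refine le_trans ?_ hP1
      have : (P1 (G c1) Z).card ≤ (P1 (G c1) Z0).card :=
        Finset.card_le_card (Finset.filter_subset_filter _ (Finset.product_subset_product hZZ0 hZZ0))
      exact_mod_cast this
    have a4 : 4000 * R ^ 2 * q ≤ Λ := by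
      rw [hΛ, le_div_iff₀ (by positivity), hnq]
      have : q * (4 * 10 ^ 8 * R ^ 5) ≤ q * t := mul_le_mul_of_nonneg_left hTR (by linarith)
      linarith
    have a5 : q ≤ R ^ 2 * q := by
      have : 1 * q ≤ R ^ 2 * q := mul_le_mul_of_nonneg_right (one_le_pow₀ (by linarith)) (by linarith)
      linarith
    have a6 : (Z.card : ℝ) + (P1 (G c1) Z).card ≤ (cod (G c) X e.1 e.2 : ℝ) := by linarith
    exact_mod_cast a6
  have key := h.fin_step hc1 hc (hZZ0.trans (hZ0.trans hYX)) hfin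
  rw [← hn, ← ht] at key
  have hBp := h.hB
  have k1 : t * (B * (0.525 * q)) ≤ t * (B * Z.card) := by gcongr
  have k2 : t * (B * (0.525 * q)) = 0.525 * (B * n) := by rw [hnq]; ring
  have k3 : 0 < B * n := by
    have : 0 < n := by linarith
    positivity
  linarith

end Ctx
end HW


namespace HW
variable {V : Type*} [DecidableEq V] {ι : Type*} [DecidableEq ι]

theorem main (r : ℕ) : ∀ (G : ι → SimpleGraph V) (C : Finset ι) (X : Finset V), C.card = r + 2 →
    Cov G C X → (0.513 : ℝ) ^ r * X.card ≤ PP G C X := by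
  induction r with
  | zero =>
    intro G C X hC hcov
    obtain ⟨i, j, hij, rfl⟩ := Finset.card_eq_two.1 hC
    have := two_cover (G i) (G j) X (by
      intro u hu v hv huv
      obtain ⟨k, hk, hadj⟩ := hcov u hu v hv huv
      rw [Finset.mem_insert, Finset.mem_singleton] at hk
      rcases hk with rfl | rfl
      · exact Or.inl hadj
      · exact Or.inr hadj)
    rw [pow_zero, one_mul, PP, Finset.prod_pair hij]
    exact_mod_cast this
  | succ r ih =>
    intro G C X hC
    induction X using Finset.strongInduction with
    | H X ihX =>
      intro hcov
      by_contra hlt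
      push Not at hlt
      have hC0 : C.Nonempty := by rw [← Finset.card_pos]; omega
      have e : (0.513 : ℝ) ^ (r + 1) = 0.513 * 0.513 ^ r := by ring
      have ctx : Ctx G C X (0.513 ^ r) := by
        refine ⟨by positivity, ?_, ?_, hcov, ?_⟩
        · intro G' i hi Z hZ
          exact ih G' (C.erase i) Z (by rw [Finset.card_erase_of_mem hi]; omega) hZ
        · intro Y hY
          rw [← e]
          exact ihX Y hY (fun u hu v hv => hcov u (hY.1 hu) v (hY.1 hv))
        · rw [← e]; exact hlt
      exact ctx.big3 hC0 (by rw [hC]; rfl)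

lemma eta_bot (X : Finset V) : eta (⊥ : SimpleGraph V) X ≤ 1 := by
  by_contra h
  obtain ⟨B, h1, h2, h3, h4⟩ := cm_eta (⊥ : SimpleGraph V) X
  obtain ⟨u, _, v, _, h⟩ := h4 ⟨0, by omega⟩ ⟨1, by omega⟩ (by simp)
  exact h

end HW

lemma HW.hadwiger_eq {n : ℕ} (G : SimpleGraph (Fin n)) :
    NG.hadwiger n G = HW.eta G Finset.univ := by
  unfold NG.hadwiger HW.eta
  congr 1
  ext m
  constructor
  · rintro ⟨B, _, h2, h3, h4⟩
    exact ⟨B, fun p => Finset.subset_univ _, h2, h3, h4⟩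
  · rintro ⟨B, _, h2, h3, h4⟩
    exact ⟨B, fun p => HW.Conn.nonempty (h2 p), h2, h3, h4⟩

lemma HW.exists_decomp (r n : ℕ) (hr : 2 ≤ r) : ∃ G : Fin r → SimpleGraph (Fin n),
    NG.IsDecomp G ∧ ∏ i, NG.hadwiger n (G i) ≤ n := by
  refine ⟨fun i => if i = ⟨0, by omega⟩ then ⊤ else ⊥, ⟨?_, ?_⟩, ?_⟩
  · intro i j hij
    by_cases hi : i = ⟨0, by omega⟩
    · have hj : j ≠ ⟨0, by omega⟩ := fun h => hij (hi.trans h.symm)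
      simp only [if_neg hj]
      exact disjoint_bot_right
    · simp only [if_neg hi]
      exact disjoint_bot_left
  · apply top_le_iff.1
    refine le_trans ?_ (le_iSup _ (⟨0, by omega⟩ : Fin r))
    simp
  · rw [← Finset.mul_prod_erase Finset.univ _ (Finset.mem_univ (⟨0, by omega⟩ : Fin r))]
    have h1 : ∏ i ∈ Finset.univ.erase (⟨0, by omega⟩ : Fin r),
        NG.hadwiger n (if i = ⟨0, by omega⟩ then ⊤ else ⊥) ≤ 1 := by
      apply Finset.prod_le_one'
      intro i hi
      rw [if_neg (Finset.ne_of_mem_erase hi), HW.hadwiger_eq]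
      exact HW.eta_bot _
    have h2 : NG.hadwiger n (if (⟨0, by omega⟩ : Fin r) = ⟨0, by omega⟩ then ⊤ else ⊥) ≤ n := by
      rw [HW.hadwiger_eq]
      exact (HW.eta_le_card _ _).trans (by simp)
    exact (Nat.mul_le_mul h2 h1).trans (by omega)

/-- For all `r ≥ 2` and `n ≥ 1`: `(0.513)^(r−2)·n ≤ NGΠ↓_η(r;n) ≤ n`. -/
theorem statement17 (r n : ℕ) (hr : 2 ≤ r) (hn : 1 ≤ n) :
    (0.513 : ℝ) ^ (r - 2) * n ≤ (NG.NGprodLow (NG.hadwiger n) r : ℝ) ∧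
    NG.NGprodLow (NG.hadwiger n) r ≤ n := by
  obtain ⟨G0, hG0, hle⟩ := HW.exists_decomp r n hr
  constructor
  · have hne : {s | ∃ G : Fin r → SimpleGraph (Fin n), NG.IsDecomp G ∧
        ∏ i, NG.hadwiger n (G i) = s}.Nonempty := ⟨_, G0, hG0, rfl⟩
    obtain ⟨G, hG, hs⟩ := Nat.sInf_mem hne
    have hs' : ∏ i, NG.hadwiger n (G i) = NG.NGprodLow (NG.hadwiger n) r := hs
    rw [← hs']
    have hcov : HW.Cov G Finset.univ Finset.univ := by
      intro u _ v _ huv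
      have h1 : (⨆ i, G i).Adj u v := by rw [hG.2]; exact huv
      rw [SimpleGraph.iSup_adj] at h1
      obtain ⟨i, hi⟩ := h1
      exact ⟨i, Finset.mem_univ _, hi⟩
    have := HW.main (r - 2) G Finset.univ Finset.univ (by rw [Finset.card_fin]; omega) hcov
    rw [HW.PP, Finset.card_fin] at this
    simp only [HW.hadwiger_eq, Nat.cast_prod]
    exact this
  · have h1 : NG.NGprodLow (NG.hadwiger n) r ≤ ∏ i, NG.hadwiger n (G0 i) := by
      unfold NG.NGprodLow
      exact Nat.sInf_le ⟨G0, hG0, rfl⟩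
    exact h1.trans hle
end
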